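/- Let w be a generalized Jacobi weight function on [-1,1], i.e., w(x) = h(x)(1-x)^α(1+x)^β ∏_{i=1}^ℓ |x-s_i|^{γ_i} where h is a measurable function on [-1,1] bounded away from zero and infinity, ℓ ≥ 0 is an integer, -1 < s_1 < … < s_ℓ < 1, and α, β, γ_1, …, γ_ℓ > -1. Set κ := max{1, 2(α+1), 2(β+1), γ_1+1, …, γ_ℓ+1}. Then there exist positive constants c and C (depending on w) such that for every integer n ≥ 1: every Chebyshev-type quadrature of degree n for w has at least c·n^κ nodes, and for every integer N ≥ C·n^κ there exists a Chebyshev-type quadrature of degree n for w with exactly N nodes. -/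

import Mathlib

open MeasureTheory Real Set

noncomputable section

/-- A Chebyshev-type quadrature of degree `n` for `w` with `N` nodes. -/
def IsChebQuad (w : ℝ → ℝ) (n N : ℕ) (t : Fin N → ℝ) : Prop :=
  Monotone t ∧ (∀ i, t i ∈ Icc (-1:ℝ) 1) ∧
  ∀ p : Polynomial ℝ, p.natDegree ≤ n →
    (∫ x in (-1:ℝ)..1, p.eval x * w x) =
      ((∫ x in (-1:ℝ)..1, w x) / N) * ∑ i, p.eval (t i)

/-! ### Riesz interpolation and the Bernstein inequality in `L¹` -/

/-- Riesz's interpolation formula for the derivative of a trigonometric polynomial. -/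
lemma exists_riesz_coeff (n : ℕ) (hn : 1 ≤ n) :
    ∃ c τ : ℕ → ℝ, ∑ j ∈ Finset.range (2 * n), |c j| ≤ n ∧
      ∀ k : ℕ, k ≤ n → ∀ x : ℝ,
        ∑ j ∈ Finset.range (2 * n), c j * cos (x + k * τ j) = -(k * sin x) := by
  have hn0 : (n : ℝ) ≠ 0 := by positivity
  have hn0' : (n : ℂ) ≠ 0 := by exact_mod_cast hn0
  set τ : ℕ → ℝ := fun j => (2 * j + 1) * π / (2 * n) with hτ
  set lam : ℕ → ℝ := fun j => (-1) ^ j / sin (τ j / 2) ^ 2 with hlam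
  have hsin : ∀ j ∈ Finset.range (2 * n), 0 < sin (τ j / 2) := by
    intro j hj
    have hj' : (j : ℝ) + 1 ≤ 2 * n := by
      exact_mod_cast Finset.mem_range.1 hj
    apply sin_pos_of_pos_of_lt_pi
    · simp only [hτ]; positivity
    · simp only [hτ]
      rw [div_div, div_lt_iff₀ (by positivity)]
      nlinarith [pi_pos]
  set S : ℕ → ℂ := fun m => ∑ j ∈ Finset.range (2 * n),
    (lam j : ℂ) * Complex.exp (m * τ j * Complex.I) with hS
  have hexpn : ∀ j : ℕ, Complex.exp (n * τ j * Complex.I) = Complex.I * (-1) ^ j := by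
    intro j
    have : (n : ℂ) * τ j * Complex.I = π / 2 * Complex.I + j * (π * Complex.I) := by
      simp only [hτ]; push_cast; field_simp; ring
    rw [this, Complex.exp_add, Complex.exp_pi_div_two_mul_I, Complex.exp_nat_mul,
      Complex.exp_pi_mul_I]
  have hgeom : ∀ m : ℕ, m < n →
      ∑ j ∈ Finset.range (2 * n), ((-1 : ℂ) ^ j) * Complex.exp (m * τ j * Complex.I) = 0 := by
    intro m hm
    set q : ℂ := Complex.exp ((m + n : ℕ) * π / n * Complex.I) with hq
    have hterm : ∀ j : ℕ, ((-1 : ℂ) ^ j) * Complex.exp (m * τ j * Complex.I) =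
        (-Complex.I * Complex.exp ((m + n : ℕ) * π / (2 * n) * Complex.I)) * q ^ j := by
      intro j
      have h1 : ((-1 : ℂ) ^ j) = -Complex.I * Complex.exp (n * τ j * Complex.I) := by
        rw [hexpn, ← mul_assoc]; simp
      rw [h1, hq, ← Complex.exp_nat_mul, mul_assoc (-Complex.I), mul_assoc (-Complex.I),
        ← Complex.exp_add, ← Complex.exp_add]
      congr 2
      simp only [hτ]; push_cast; field_simp; ring
    rw [Finset.sum_congr rfl fun j _ => hterm j, ← Finset.mul_sum]
    have hq1 : q ≠ 1 := by
      intro h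
      rw [hq, Complex.exp_eq_one_iff] at h
      obtain ⟨z, hz⟩ := h
      have hz' : ((m + n : ℕ) : ℂ) = ((2 * z * n : ℤ) : ℂ) := by
        have hpi : (π : ℂ) ≠ 0 := by exact_mod_cast pi_ne_zero
        have := Complex.I_ne_zero
        field_simp at hz
        push_cast at hz ⊢
        rw [hz]; ring
      have hz'' : ((m + n : ℕ) : ℤ) = 2 * z * n := by exact_mod_cast hz'
      push_cast at hz''
      have hm' : (m : ℤ) < n := by exact_mod_cast hm
      have hm0 : (0 : ℤ) ≤ m := by positivity
      rcases le_or_gt z 0 with h | h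
      · nlinarith
      · nlinarith
    have : ∑ j ∈ Finset.range (2 * n), q ^ j = 0 := by
      rw [geom_sum_eq hq1, hq, ← Complex.exp_nat_mul]
      have : ((2 * n : ℕ) : ℂ) * ((m + n : ℕ) * π / n * Complex.I) =
          (m + n : ℕ) * (2 * π * Complex.I) := by push_cast; field_simp
      rw [this, Complex.exp_nat_mul, Complex.exp_two_pi_mul_I]; simp
    rw [this, mul_zero]
  have hdiff : ∀ m : ℕ, m < n → ∑ j ∈ Finset.range (2 * n), (lam j : ℂ) *
      Complex.exp (m * τ j * Complex.I) *
        (Complex.exp (τ j * Complex.I) + Complex.exp (-(τ j * Complex.I)) - 2) = 0 := by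
    intro m hm
    have : ∀ j ∈ Finset.range (2 * n), (lam j : ℂ) * Complex.exp (m * τ j * Complex.I) *
        (Complex.exp (τ j * Complex.I) + Complex.exp (-(τ j * Complex.I)) - 2) =
        -4 * (((-1 : ℂ) ^ j) * Complex.exp (m * τ j * Complex.I)) := by
      intro j hj
      have h2 : Complex.exp (τ j * Complex.I) + Complex.exp (-(τ j * Complex.I)) - 2 =
          -4 * ((sin (τ j / 2) ^ 2 : ℝ) : ℂ) := by
        have hc : Complex.exp (τ j * Complex.I) + Complex.exp (-(τ j * Complex.I)) =
            2 * ((cos (τ j) : ℝ) : ℂ) := by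
          rw [Complex.ofReal_cos, Complex.cos]; ring_nf
        have hc2 : cos (τ j) = 1 - 2 * sin (τ j / 2) ^ 2 := by
          have := cos_two_mul (τ j / 2)
          rw [mul_div_cancel₀ _ two_ne_zero] at this
          rw [this, cos_sq']; ring
        rw [hc, hc2]; push_cast; ring
      have h3 : (lam j : ℂ) * ((sin (τ j / 2) ^ 2 : ℝ) : ℂ) = (-1) ^ j := by
        have : lam j * sin (τ j / 2) ^ 2 = (-1) ^ j :=
          div_mul_cancel₀ _ (pow_ne_zero _ (hsin j hj).ne')
        rw [← Complex.ofReal_mul, this]; push_cast; rfl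
      rw [h2, ← h3]; ring
    rw [Finset.sum_congr rfl this, ← Finset.mul_sum, hgeom m hm, mul_zero]
  have hrec : ∀ m : ℕ, m + 1 < n → S (m + 2) - 2 * S (m + 1) + S m = 0 := by
    intro m hm
    rw [← hdiff (m + 1) hm, hS]
    simp only
    rw [Finset.mul_sum, ← Finset.sum_sub_distrib, ← Finset.sum_add_distrib]
    refine Finset.sum_congr rfl fun j _ => ?_
    have e1 : Complex.exp ((m + 2 : ℕ) * τ j * Complex.I) =
        Complex.exp ((m + 1 : ℕ) * τ j * Complex.I) * Complex.exp (τ j * Complex.I) := by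
      rw [← Complex.exp_add]; congr 1; push_cast; ring
    have e2 : Complex.exp (m * τ j * Complex.I) =
        Complex.exp ((m + 1 : ℕ) * τ j * Complex.I) * Complex.exp (-(τ j * Complex.I)) := by
      rw [← Complex.exp_add]; congr 1; push_cast; ring
    rw [e1, e2]; ring
  have hre0 : (S 1).re = (S 0).re := by
    have := congrArg Complex.re (hdiff 0 (by omega))
    simp only [Nat.cast_zero, zero_mul, Complex.exp_zero, mul_one, Complex.re_sum,
      Complex.zero_re, ← neg_mul] at this
    simp only [hS, Complex.re_sum, Nat.cast_zero, zero_mul, Complex.exp_zero, mul_one,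
      Nat.cast_one, one_mul]
    have e : ∀ j, ((lam j : ℂ) * (Complex.exp (τ j * Complex.I) +
        Complex.exp (-τ j * Complex.I) - 2)).re =
        2 * (((lam j : ℂ) * Complex.exp (τ j * Complex.I)).re - (lam j : ℂ).re) := by
      intro j
      rw [Complex.re_ofReal_mul, Complex.re_ofReal_mul, Complex.sub_re, Complex.add_re,
        Complex.exp_ofReal_mul_I_re, ← Complex.ofReal_neg, Complex.exp_ofReal_mul_I_re]
      simp; ring
    rw [Finset.sum_congr rfl fun j _ => e j, ← Finset.mul_sum, Finset.sum_sub_distrib] at this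
    linarith
  have hre : ∀ m, m ≤ n → (S m).re = (S 0).re := by
    intro m
    induction m using Nat.strong_induction_on with
    | _ m ih =>
      match m with
      | 0 => intro _; rfl
      | 1 => intro _; exact hre0
      | m + 2 =>
        intro hm
        have h := congrArg Complex.re (hrec m (by omega))
        have h1 := ih (m + 1) (by omega) (by omega)
        have h2 := ih m (by omega) (by omega)
        simp at h
        linarith
  have him0 : (S 0).im = 0 := by simp [hS]
  have him : ∀ m : ℕ, m ≤ n → (S m).im = m * (S 1).im := by
    intro m
    induction m using Nat.strong_induction_on with
    | _ m ih =>
      match m with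
      | 0 => intro _; simp [him0]
      | 1 => intro _; simp
      | m + 2 =>
        intro hm
        have h := congrArg Complex.im (hrec m (by omega))
        have h1 := ih (m + 1) (by omega) (by omega)
        have h2 := ih m (by omega) (by omega)
        simp at h
        rw [h1, h2] at h
        push_cast at h ⊢
        linarith
  have hSn : S n = Complex.I * ((∑ j ∈ Finset.range (2 * n), |lam j| : ℝ) : ℂ) := by
    simp only [hS]
    push_cast
    rw [Finset.mul_sum]
    refine Finset.sum_congr rfl fun j _ => ?_
    have : |lam j| = lam j * (-1) ^ j := by
      simp only [hlam]
      rw [abs_div, abs_pow, abs_neg, abs_one, one_pow, abs_of_nonneg (sq_nonneg _),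
        div_mul_eq_mul_div, ← mul_pow]
      simp
    rw [hexpn, this]; push_cast; ring
  set b := (S 1).im with hb
  have hbn : n * b = ∑ j ∈ Finset.range (2 * n), |lam j| := by
    rw [← him n le_rfl, hSn]; simp
  have hS0 : (S 0).re = 0 := by
    rw [← hre n le_rfl, hSn]; simp
  have hlam_pos : 0 < ∑ j ∈ Finset.range (2 * n), |lam j| := by
    refine Finset.sum_pos (fun j hj => abs_pos.2 ?_) ⟨0, by simp; omega⟩
    exact div_ne_zero (pow_ne_zero _ (by norm_num)) (pow_ne_zero _ (hsin j hj).ne')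
  have hbpos : 0 < b := by
    have : 0 < (n : ℝ) * b := hbn ▸ hlam_pos
    exact pos_of_mul_pos_right this (by positivity)
  have hSk : ∀ k : ℕ, k ≤ n → S k = Complex.I * ((k * b : ℝ) : ℂ) := by
    intro k hk
    apply Complex.ext
    · rw [hre k hk, hS0]; simp
    · rw [him k hk]; simp
  refine ⟨fun j => lam j / b, τ, ?_, ?_⟩
  · simp only [abs_div, abs_of_pos hbpos]
    rw [← Finset.sum_div, ← hbn, mul_div_cancel_right₀ _ hbpos.ne']
  · intro k hk x
    have h := congrArg Complex.re
      (congrArg (fun z => Complex.exp (x * Complex.I) * z) (hSk k hk))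
    simp only [hS, Finset.mul_sum, Complex.re_sum] at h
    have e1 : ∀ j, (Complex.exp (x * Complex.I) *
        ((lam j : ℂ) * Complex.exp (k * τ j * Complex.I))).re = lam j * cos (x + k * τ j) := by
      intro j
      rw [mul_left_comm, ← Complex.exp_add, Complex.re_ofReal_mul,
        ← Complex.exp_ofReal_mul_I_re]
      congr 3; push_cast; ring
    have e2 : (Complex.exp (x * Complex.I) * (Complex.I * ((k * b : ℝ) : ℂ))).re =
        -(k * sin x) * b := by
      rw [← mul_assoc, Complex.re_mul_ofReal, Complex.mul_re, Complex.exp_ofReal_mul_I_im]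
      simp; ring
    rw [Finset.sum_congr rfl fun j _ => e1 j, e2] at h
    rw [← mul_left_inj' hbpos.ne', ← h, Finset.sum_mul]
    refine Finset.sum_congr rfl fun j _ => ?_
    field_simp

/-- Real trigonometric polynomials of degree at most `n`. -/
def trigPoly (n : ℕ) : Submodule ℝ (ℝ → ℝ) :=
  Submodule.span ℝ {f | ∃ k : ℕ, k ≤ n ∧ ∃ φ : ℝ, f = fun x => cos (k * x + φ)}

lemma cos_mem_trigPoly {n k : ℕ} (hk : k ≤ n) (φ : ℝ) :
    (fun x => cos (k * x + φ)) ∈ trigPoly n :=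
  Submodule.subset_span ⟨k, hk, φ, rfl⟩

lemma trigPoly_mono {m n : ℕ} (h : m ≤ n) : trigPoly m ≤ trigPoly n :=
  Submodule.span_mono fun _ ⟨k, hk, φ, hf⟩ => ⟨k, hk.trans h, φ, hf⟩

lemma trigPoly_periodic {n : ℕ} {f : ℝ → ℝ} (hf : f ∈ trigPoly n) :
    Function.Periodic f (2 * π) := by
  induction hf using Submodule.span_induction with
  | mem f h =>
    obtain ⟨k, -, φ, rfl⟩ := h
    intro x
    have : (k : ℝ) * (x + 2 * π) + φ = k * x + φ + k * (2 * π) := by ring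
    simp only [this, cos_add_nat_mul_two_pi]
  | zero => intro x; rfl
  | add f g _ _ hf hg => exact hf.add hg
  | smul a f _ hf => exact hf.smul a

lemma trigPoly_translate {n : ℕ} {f : ℝ → ℝ} (hf : f ∈ trigPoly n) (τ : ℝ) :
    (fun x => f (x + τ)) ∈ trigPoly n := by
  induction hf using Submodule.span_induction with
  | mem f h =>
    obtain ⟨k, hk, φ, rfl⟩ := h
    convert cos_mem_trigPoly hk (k * τ + φ) using 3
    ring
  | zero => exact Submodule.zero_mem _
  | add f g _ _ hf hg => exact Submodule.add_mem _ hf hg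
  | smul a f _ hf => exact Submodule.smul_mem _ a hf

lemma trigPoly_mul_cos {n : ℕ} {f : ℝ → ℝ} (hf : f ∈ trigPoly n) :
    (fun x => f x * cos x) ∈ trigPoly (n + 1) := by
  induction hf using Submodule.span_induction with
  | mem f h =>
    obtain ⟨k, hk, φ, rfl⟩ := h
    have key : (fun x => cos (k * x + φ) * cos x) =
        (1 / 2 : ℝ) • ((fun x : ℝ => cos (((k + 1 : ℕ) : ℝ) * x + φ)) +
          fun x => cos (k * x + φ - x)) := by
      funext x
      simp only [Pi.smul_apply, Pi.add_apply, smul_eq_mul]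
      have : (((k + 1 : ℕ) : ℝ) * x + φ) = (k * x + φ) + x := by push_cast; ring
      rw [this, cos_add (k * x + φ) x, cos_sub (k * x + φ) x]; ring
    rw [key]
    refine Submodule.smul_mem _ _ (Submodule.add_mem _ (cos_mem_trigPoly (by omega) φ) ?_)
    rcases k with _ | k
    · convert cos_mem_trigPoly (n := n + 1) (k := 1) (by omega) (-φ) using 2 with x
      rw [← cos_neg]; congr 1; push_cast; ring_nf
    · convert cos_mem_trigPoly (n := n + 1) (k := k) (by omega) φ using 2 with x
      congr 1; push_cast; ring
  | zero => convert Submodule.zero_mem (trigPoly (n + 1)) using 2; simp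
  | add f g _ _ hf hg =>
    convert Submodule.add_mem _ hf hg using 1
    funext x; simp [add_mul]
  | smul a f _ hf =>
    convert Submodule.smul_mem _ a hf using 1
    funext x; simp [mul_assoc]

lemma cos_pow_mem_trigPoly (k : ℕ) : (fun x => cos x ^ k) ∈ trigPoly k := by
  induction k with
  | zero => simpa using cos_mem_trigPoly (n := 0) (k := 0) le_rfl 0
  | succ k ih => simpa [pow_succ] using trigPoly_mul_cos ih

lemma exists_trigPoly_deriv {n : ℕ} (hn : 1 ≤ n) :
    ∃ c τ : ℕ → ℝ, ∑ j ∈ Finset.range (2 * n), |c j| ≤ n ∧ ∀ f ∈ trigPoly n, ∀ x,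
      HasDerivAt f (∑ j ∈ Finset.range (2 * n), c j * f (x + τ j)) x := by
  obtain ⟨c, τ, hc, h⟩ := exists_riesz_coeff n hn
  refine ⟨c, τ, hc, fun f hf => ?_⟩
  induction hf using Submodule.span_induction with
  | mem f hf =>
    obtain ⟨k, hk, φ, rfl⟩ := hf
    intro x
    have h1 : HasDerivAt (fun x : ℝ => cos (k * x + φ)) (-sin (k * x + φ) * (k * 1)) x :=
      (((hasDerivAt_id x).const_mul (k : ℝ)).add_const φ).cos
    convert h1 using 1
    have h2 := h k hk (k * x + φ)
    rw [mul_one, neg_mul, mul_comm (sin _), ← h2]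
    refine Finset.sum_congr rfl fun j _ => ?_
    congr 2; ring_nf
  | zero => intro x; simp [hasDerivAt_zero]
  | add f g _ _ hf hg =>
    intro x
    refine ((hf x).add (hg x)).congr_deriv ?_
    rw [← Finset.sum_add_distrib]
    exact Finset.sum_congr rfl fun j _ => by rw [Pi.add_apply]; ring
  | smul a f _ hf =>
    intro x
    refine ((hf x).const_smul a).congr_deriv ?_
    simp only [Pi.smul_apply, smul_eq_mul, Finset.mul_sum]
    exact Finset.sum_congr rfl fun j _ => by ring

lemma trigPoly_differentiable {n : ℕ} {f : ℝ → ℝ} (hf : f ∈ trigPoly n) :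
    Differentiable ℝ f := by
  obtain ⟨c, τ, -, h⟩ := exists_trigPoly_deriv (n := n + 1) (by omega)
  exact fun x => (h f (trigPoly_mono (by omega) hf) x).differentiableAt

lemma trigPoly_continuous {n : ℕ} {f : ℝ → ℝ} (hf : f ∈ trigPoly n) : Continuous f :=
  (trigPoly_differentiable hf).continuous

lemma trigPoly_deriv_mem {n : ℕ} (hn : 1 ≤ n) {f : ℝ → ℝ} (hf : f ∈ trigPoly n) :
    deriv f ∈ trigPoly n := by
  obtain ⟨c, τ, -, h⟩ := exists_trigPoly_deriv hn
  have : deriv f = ∑ j ∈ Finset.range (2 * n), c j • fun x => f (x + τ j) := by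
    funext x
    rw [(h f hf x).deriv]; simp
  rw [this]
  exact Submodule.sum_mem _ fun j _ => Submodule.smul_mem _ _ (trigPoly_translate hf _)

lemma integral_abs_translate_trigPoly {n : ℕ} {f : ℝ → ℝ} (hf : f ∈ trigPoly n) (s : ℝ) :
    ∫ x in (0 : ℝ)..2 * π, |f (x + s)| = ∫ x in (0 : ℝ)..2 * π, |f x| := by
  have hp : Function.Periodic (fun x => |f x|) (2 * π) :=
    fun x => by simp only [trigPoly_periodic hf x]
  rw [intervalIntegral.integral_comp_add_right (fun x => |f x|), zero_add, add_comm (2 * π) s,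
    hp.intervalIntegral_add_eq s 0, zero_add]

/-- Bernstein's inequality in `L¹`. -/
lemma bernstein_L1 {n : ℕ} (hn : 1 ≤ n) {f : ℝ → ℝ} (hf : f ∈ trigPoly n) :
    ∫ x in (0 : ℝ)..2 * π, |deriv f x| ≤ n * ∫ x in (0 : ℝ)..2 * π, |f x| := by
  obtain ⟨c, τ, hc, h⟩ := exists_trigPoly_deriv hn
  have hcont := trigPoly_continuous hf
  have hint : ∀ j ∈ Finset.range (2 * n),
      IntervalIntegrable (fun x => |c j| * |f (x + τ j)|) volume 0 (2 * π) := fun j _ =>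
    Continuous.intervalIntegrable (by fun_prop) _ _
  calc ∫ x in (0 : ℝ)..2 * π, |deriv f x|
      ≤ ∫ x in (0 : ℝ)..2 * π, ∑ j ∈ Finset.range (2 * n), |c j| * |f (x + τ j)| := by
        refine intervalIntegral.integral_mono_on two_pi_pos.le
          ((trigPoly_continuous (trigPoly_deriv_mem hn hf)).abs.intervalIntegrable _ _)
          (Continuous.intervalIntegrable (by fun_prop) _ _) fun x _ => ?_
        rw [(h f hf x).deriv]
        refine (Finset.abs_sum_le_sum_abs _ _).trans_eq ?_
        simp only [abs_mul]
    _ = (∑ j ∈ Finset.range (2 * n), |c j|) * ∫ x in (0 : ℝ)..2 * π, |f x| := by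
        rw [intervalIntegral.integral_finsetSum hint, Finset.sum_mul]
        refine Finset.sum_congr rfl fun j _ => ?_
        rw [intervalIntegral.integral_const_mul, integral_abs_translate_trigPoly hf]
    _ ≤ _ := by
        gcongr
        exact intervalIntegral.integral_nonneg two_pi_pos.le fun x _ => abs_nonneg _

/-- A sup-norm bound for the derivative of a trigonometric polynomial. -/
lemma abs_deriv_trigPoly_le {n : ℕ} (hn : 1 ≤ n) {f : ℝ → ℝ} (hf : f ∈ trigPoly n) (x : ℝ) :
    |deriv f x| ≤ n * (n * ∫ x in (0 : ℝ)..2 * π, |f x|) := by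
  have hf1 := trigPoly_deriv_mem hn hf
  have hf2 := trigPoly_deriv_mem hn hf1
  have hper := trigPoly_periodic hf
  obtain ⟨z, hz, hz0⟩ := exists_deriv_eq_zero (f := f) (a := x) (b := x + 2 * π)
    (by linarith [pi_pos]) (trigPoly_continuous hf).continuousOn (hper x).symm
  have hc2 := (trigPoly_continuous hf2).abs
  have hp2 : Function.Periodic (fun x => |deriv (deriv f) x|) (2 * π) :=
    fun x => by simp only [trigPoly_periodic hf2 x]
  have hftc : ∫ y in x..z, deriv (deriv f) y = deriv f z - deriv f x :=
    intervalIntegral.integral_deriv_eq_sub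
      (fun y _ => trigPoly_differentiable hf1 y)
      ((trigPoly_continuous hf2).intervalIntegrable _ _)
  calc |deriv f x| = |∫ y in x..z, deriv (deriv f) y| := by rw [hftc, hz0, zero_sub, abs_neg]
    _ ≤ ∫ y in x..z, |deriv (deriv f) y| :=
        intervalIntegral.abs_integral_le_integral_abs hz.1.le
    _ ≤ ∫ y in x..x + 2 * π, |deriv (deriv f) y| :=
        intervalIntegral.integral_mono_interval le_rfl hz.1.le hz.2.le
          (Filter.Eventually.of_forall fun _ => abs_nonneg _) (hc2.intervalIntegrable _ _)
    _ = ∫ y in (0 : ℝ)..2 * π, |deriv (deriv f) y| := by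
        rw [hp2.intervalIntegral_add_eq x 0, zero_add]
    _ ≤ n * ∫ y in (0 : ℝ)..2 * π, |deriv f y| := bernstein_L1 hn hf1
    _ ≤ _ := by gcongr; exact bernstein_L1 hn hf

/-! ### A sampling inequality -/

lemma integral_abs_zero_pi {f : ℝ → ℝ} (hc : Continuous f)
    (hp : Function.Periodic f (2 * π)) (hodd : ∀ x, f (-x) = -f x) :
    ∫ x in (0 : ℝ)..2 * π, |f x| = 2 * ∫ x in (0 : ℝ)..π, |f x| := by
  have hp' : Function.Periodic (fun x => |f x|) (2 * π) := fun x => by simp only [hp x]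
  have h1 := hp'.intervalIntegral_add_eq 0 (-π)
  rw [zero_add, show -π + 2 * π = π by ring] at h1
  have hi : ∀ a b, IntervalIntegrable (fun x => |f x|) volume a b :=
    fun a b => hc.abs.intervalIntegrable a b
  have h2 : ∫ x in (-π)..0, |f x| = ∫ x in (0 : ℝ)..π, |f x| := by
    have := intervalIntegral.integral_comp_neg (a := 0) (b := π) (fun x => |f x|)
    rw [neg_zero] at this
    rw [← this]
    simp only [hodd, abs_neg]
  rw [h1, ← intervalIntegral.integral_add_adjacent_intervals (hi (-π) 0) (hi 0 π), h2]
  ring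

lemma trigPoly_sampling {n : ℕ} (hn : 1 ≤ n) {g : ℝ → ℝ} (hg : g ∈ trigPoly n)
    {N : ℕ} {a : ℕ → ℝ} (ha0 : a 0 = 0) (haN : a N = π)
    (hmono : ∀ i < N, a i ≤ a (i + 1)) (hstep : ∀ i < N, a (i + 1) - a i ≤ 1 / (32 * n))
    (θ : Fin N → ℝ) (hθ : ∀ i : Fin N, |θ i - a i| ≤ 3 * (a (i + 1) - a i)) :
    (∫ x in (0 : ℝ)..π, |g x|) - (1 / 4) * ∫ x in (0 : ℝ)..2 * π, |g x| ≤
      ∑ i : Fin N, (a (i + 1) - a i) * |g (θ i)| := by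
  set δ : ℝ := 1 / (8 * n) with hδ
  have hn' : (0 : ℝ) < n := by exact_mod_cast hn
  have hδ0 : 0 ≤ δ := by positivity
  have hg' := trigPoly_deriv_mem hn hg
  have hcg := trigPoly_continuous hg
  have hcg' := trigPoly_continuous hg'
  set H : ℝ → ℝ := fun x => ∫ s in (-δ)..δ, |deriv g (x + s)| with hH
  have hHc : Continuous H := by
    apply intervalIntegral.continuous_parametric_intervalIntegral_of_continuous'
    fun_prop
  have hosc : ∀ x y, |x - y| ≤ δ → |g x| ≤ |g y| + H x := by
    intro x y hxy
    have h1 : H x = ∫ s in (x - δ)..(x + δ), |deriv g s| := by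
      simp only [hH]
      rw [intervalIntegral.integral_comp_add_left (fun s => |deriv g s|) x, sub_eq_add_neg]
    have h2 : ∫ s in y..x, deriv g s = g x - g y :=
      intervalIntegral.integral_deriv_eq_sub (fun z _ => trigPoly_differentiable hg z)
        (hcg'.intervalIntegrable _ _)
    have h3 : |g x - g y| ≤ H x := by
      rw [← h2, h1]
      have hb := abs_le.1 hxy
      rcases le_total y x with hyx | hyx
      · refine (intervalIntegral.abs_integral_le_integral_abs hyx).trans ?_
        exact intervalIntegral.integral_mono_interval (by linarith) hyx (by linarith)
          (Filter.Eventually.of_forall fun _ => abs_nonneg _) (hcg'.abs.intervalIntegrable _ _)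
      · rw [intervalIntegral.integral_symm, abs_neg]
        refine (intervalIntegral.abs_integral_le_integral_abs hyx).trans ?_
        exact intervalIntegral.integral_mono_interval (by linarith) hyx (by linarith)
          (Filter.Eventually.of_forall fun _ => abs_nonneg _) (hcg'.abs.intervalIntegrable _ _)
    have := abs_sub_abs_le_abs_sub (g x) (g y)
    linarith
  have hHint : ∫ x in (0 : ℝ)..π, H x ≤ (1 / 4) * ∫ x in (0 : ℝ)..2 * π, |g x| := by
    have hHnn : ∀ x, 0 ≤ H x := fun x =>
      intervalIntegral.integral_nonneg (by linarith) fun _ _ => abs_nonneg _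
    calc ∫ x in (0 : ℝ)..π, H x ≤ ∫ x in (0 : ℝ)..2 * π, H x :=
          intervalIntegral.integral_mono_interval le_rfl pi_pos.le (by linarith [pi_pos])
            (Filter.Eventually.of_forall hHnn) (hHc.intervalIntegrable _ _)
      _ = ∫ s in (-δ)..δ, ∫ x in (0 : ℝ)..2 * π, |deriv g (x + s)| := by
          simp only [hH]
          apply intervalIntegral_intervalIntegral_swap
          apply IntegrableOn.mono_set (t := Set.uIcc 0 (2 * π) ×ˢ Set.uIcc (-δ) δ)
          · apply ContinuousOn.integrableOn_compact
            · exact isCompact_uIcc.prod isCompact_uIcc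
            · apply Continuous.continuousOn
              unfold Function.uncurry
              fun_prop
          · exact Set.prod_mono Set.uIoc_subset_uIcc Set.uIoc_subset_uIcc
      _ = 2 * δ * ∫ x in (0 : ℝ)..2 * π, |deriv g x| := by
          simp only [integral_abs_translate_trigPoly hg']
          rw [intervalIntegral.integral_const, smul_eq_mul]; ring
      _ ≤ 2 * δ * (n * ∫ x in (0 : ℝ)..2 * π, |g x|) := by
          gcongr; exact bernstein_L1 hn hg
      _ = _ := by simp only [hδ]; field_simp; ring
  have hcell : ∀ i : Fin N, ∫ x in a i..a (i + 1), |g x| ≤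
      (a (i + 1) - a i) * |g (θ i)| + ∫ x in a i..a (i + 1), H x := by
    intro i
    have hle := hmono i i.2
    calc ∫ x in a i..a (i + 1), |g x| ≤ ∫ x in a i..a (i + 1), (|g (θ i)| + H x) := by
          refine intervalIntegral.integral_mono_on hle (hcg.abs.intervalIntegrable _ _)
            (Continuous.intervalIntegrable (by fun_prop) _ _) fun x hx => hosc x (θ i) ?_
          have h1 := abs_le.1 (hθ i)
          have h2 := hstep i i.2
          have h3 : 4 * (1 / (32 * (n : ℝ))) = δ := by rw [hδ]; field_simp; norm_num
          rw [abs_le]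
          constructor <;> nlinarith [hx.1, hx.2]
      _ = _ := by
          rw [intervalIntegral.integral_add (by simp) (hHc.intervalIntegrable _ _),
            intervalIntegral.integral_const, smul_eq_mul]
  have hsum : ∀ f : ℝ → ℝ, Continuous f →
      ∑ i : Fin N, ∫ x in a i..a (i + 1), f x = ∫ x in (0 : ℝ)..π, f x := by
    intro f hf
    rw [← Finset.sum_range fun i => ∫ x in a i..a (i + 1), f x, ← ha0, ← haN]
    exact intervalIntegral.sum_integral_adjacent_intervals
      fun k _ => hf.intervalIntegrable _ _
  have := Finset.sum_le_sum fun i (_ : i ∈ Finset.univ) => hcell i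
  rw [Finset.sum_add_distrib, hsum _ hcg.abs, hsum _ hHc] at this
  linarith

/-! ### Solving the moment equations -/

lemma exists_box_solution {ι κ : Type*} [Fintype ι] [Fintype κ] (B : κ → ι → ℝ) (ρ : ι → ℝ)
    (hρ : ∀ i, 0 ≤ ρ i) (y : κ → ℝ)
    (h : ∀ q : κ → ℝ, ∑ k, q k * y k ≤ ∑ i, ρ i * |∑ k, q k * B k i|) :
    ∃ v : ι → ℝ, (∀ i, |v i| ≤ ρ i) ∧ ∀ k, ∑ i, B k i * v i = y k := by
  classical
  set L : (ι → ℝ) →ₗ[ℝ] (κ → ℝ) := Matrix.mulVecLin (Matrix.of B) with hL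
  have hLapp : ∀ v k, L v k = ∑ i, B k i * v i := fun v k => rfl
  set K : Set (κ → ℝ) := L '' Set.Icc (fun i => -ρ i) ρ with hK
  have hKc : IsCompact K := isCompact_Icc.image L.continuous_of_finiteDimensional
  have hKconv : Convex ℝ K := (convex_Icc _ _).linear_image L
  by_cases hy : y ∈ K
  · obtain ⟨v, hv, rfl⟩ := hy
    exact ⟨v, fun i => abs_le.2 ⟨hv.1 i, hv.2 i⟩, fun k => (hLapp v k).symm⟩
  exfalso
  obtain ⟨f, u, hfK, hfy⟩ := geometric_hahn_banach_closed_point hKconv hKc.isClosed hy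
  set q : κ → ℝ := fun k => f (Pi.single k 1) with hq
  have hf : ∀ z : κ → ℝ, f z = ∑ k, q k * z k := by
    intro z
    have := LinearMap.pi_apply_eq_sum_univ (f : (κ → ℝ) →ₗ[ℝ] ℝ) z
    simp only [ContinuousLinearMap.coe_coe, smul_eq_mul] at this
    rw [this]
    refine Finset.sum_congr rfl fun k _ => ?_
    rw [mul_comm]
    congr 2
    funext j
    simp [Pi.single_apply, eq_comm]
  set v : ι → ℝ := fun i => ρ i * SignType.sign (∑ k, q k * B k i) with hv
  have hvmem : v ∈ Set.Icc (fun i => -ρ i) ρ := by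
    have : ∀ i, |v i| ≤ ρ i := by
      intro i
      rw [hv, abs_mul, abs_of_nonneg (hρ i)]
      refine mul_le_of_le_one_right (hρ i) ?_
      rcases lt_trichotomy (∑ k, q k * B k i) 0 with h | h | h <;> simp [h]
    exact ⟨fun i => (abs_le.1 (this i)).1, fun i => (abs_le.1 (this i)).2⟩
  have h1 := hfK _ ⟨v, hvmem, rfl⟩
  have h2 := h q
  rw [hf] at h1 hfy
  have h3 : ∑ k, q k * L v k = ∑ i, ρ i * |∑ k, q k * B k i| := by
    simp only [hLapp, Finset.mul_sum]
    rw [Finset.sum_comm]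
    refine Finset.sum_congr rfl fun i _ => ?_
    rw [← self_mul_sign, ← mul_assoc, mul_comm (ρ i), mul_assoc, Finset.sum_mul]
    exact Finset.sum_congr rfl fun k _ => by simp only [hv]; ring
  linarith

/-- The trigonometric polynomial `∑ q_k cos^{k+1}`. -/
def cosPoly {n : ℕ} (q : Fin n → ℝ) : ℝ → ℝ := fun x => ∑ k : Fin n, q k * cos x ^ (k.1 + 1)

lemma cosPoly_mem_trigPoly {n : ℕ} (q : Fin n → ℝ) : cosPoly q ∈ trigPoly n := by
  have : cosPoly q = ∑ k : Fin n, q k • fun x => cos x ^ (k.1 + 1) := by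
    funext x; simp [cosPoly]
  rw [this]
  exact Submodule.sum_mem _ fun k _ => Submodule.smul_mem _ _
    (trigPoly_mono (by omega) (cos_pow_mem_trigPoly (k.1 + 1)))

lemma deriv_cosPoly {n : ℕ} (q : Fin n → ℝ) (x : ℝ) :
    deriv (cosPoly q) x = ∑ k : Fin n, q k * ((k.1 + 1) * cos x ^ k.1 * -sin x) := by
  refine HasDerivAt.deriv ?_
  refine HasDerivAt.fun_sum fun k _ => HasDerivAt.const_mul _ ?_
  simpa using (hasDerivAt_cos x).fun_pow (k.1 + 1)

lemma integral_abs_deriv_cosPoly {n : ℕ} (hn : 1 ≤ n) (q : Fin n → ℝ) :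
    ∫ x in (0 : ℝ)..2 * π, |deriv (cosPoly q) x| = 2 * ∫ x in (0 : ℝ)..π, |deriv (cosPoly q) x| := by
  have h := trigPoly_deriv_mem hn (cosPoly_mem_trigPoly q)
  refine integral_abs_zero_pi (trigPoly_continuous h) (trigPoly_periodic h) fun x => ?_
  simp [deriv_cosPoly, Finset.sum_neg_distrib]

lemma abs_taylor_le {f : ℝ → ℝ} (hf : Differentiable ℝ f) (hf' : Differentiable ℝ (deriv f))
    {M : ℝ} (hM : ∀ x, |deriv (deriv f) x| ≤ M) (x h : ℝ) :
    |f (x + h) - f x - h * deriv f x| ≤ M * h ^ 2 := by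
  have hlip : ∀ y, |deriv f y - deriv f x| ≤ M * |y - x| := fun y =>
    Convex.norm_image_sub_le_of_norm_deriv_le (s := univ) (fun z _ => hf' z)
      (fun z _ => hM z) convex_univ (mem_univ x) (mem_univ y)
  have hM0 : 0 ≤ M := (abs_nonneg _).trans (hM x)
  have hg : ∀ y, HasDerivAt (fun y => f y - y * deriv f x) (deriv f y - deriv f x) y := by
    intro y
    simpa using (hf y).hasDerivAt.fun_sub ((hasDerivAt_id y).mul_const (deriv f x))
  have h1 := Convex.norm_image_sub_le_of_norm_hasDerivWithin_le (s := Set.uIcc x (x + h))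
    (f := fun y => f y - y * deriv f x) (f' := fun y => deriv f y - deriv f x) (C := M * |h|)
    (fun y _ => (hg y).hasDerivWithinAt)
    (fun y hy => by
      refine (hlip y).trans (mul_le_mul_of_nonneg_left ?_ hM0)
      have := Set.abs_sub_left_of_mem_uIcc hy
      rwa [add_sub_cancel_left] at this)
    (convex_uIcc _ _) Set.left_mem_uIcc Set.right_mem_uIcc
  rw [Real.norm_eq_abs, Real.norm_eq_abs, add_sub_cancel_left] at h1
  calc |f (x + h) - f x - h * deriv f x|
      = |f (x + h) - (x + h) * deriv f x - (f x - x * deriv f x)| := by congr 1; ring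
    _ ≤ M * |h| * |h| := h1
    _ = M * h ^ 2 := by rw [mul_assoc, abs_mul_abs_self, sq]

/-- If a fine partition of `[0, π]` almost solves the moment equations, then there are nearby
points solving them exactly. -/
lemma exists_nodes_of_partition {n : ℕ} (hn : 1 ≤ n) {N : ℕ} {a : ℕ → ℝ}
    (ha0 : a 0 = 0) (haN : a N = π) (hmono : ∀ i < N, a i ≤ a (i + 1))
    (hstep : ∀ i < N, a (i + 1) - a i ≤ 1 / (32 * n)) (m : Fin n → ℝ)
    (herr : ∀ q : Fin n → ℝ,
      |∑ i : Fin N, cosPoly q (a i) - ∑ k, q k * m k| ≤ ∫ x in (0 : ℝ)..π, |deriv (cosPoly q) x|) :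
    ∃ θ : Fin N → ℝ, ∀ q : Fin n → ℝ, ∑ i, cosPoly q (θ i) = ∑ k, q k * m k := by
  set V : (Fin n → ℝ) → ℝ := fun q => ∫ x in (0 : ℝ)..π, |deriv (cosPoly q) x| with hV
  have hV0 : ∀ q, 0 ≤ V q := fun q =>
    intervalIntegral.integral_nonneg pi_pos.le fun _ _ => abs_nonneg _
  set ρ : Fin N → ℝ := fun i => a (i + 1) - a i with hρ
  have hρ0 : ∀ i, 0 ≤ ρ i := fun i => sub_nonneg.2 (hmono i i.2)
  set E : (Fin N → ℝ) → (Fin n → ℝ) → ℝ :=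
    fun θ q => ∑ i, cosPoly q (θ i) - ∑ k, q k * m k with hE
  set S : Set (ℝ × (Fin N → ℝ)) := {p | (0 ≤ p.1 ∧ p.1 ≤ 1) ∧
    (∀ i : Fin N, |p.2 i - a i| ≤ 3 * (1 - p.1) * ρ i) ∧ ∀ q, |E p.2 q| ≤ p.1 * V q} with hS
  have hcp : ∀ q : Fin n → ℝ, Continuous (cosPoly q) := fun q =>
    trigPoly_continuous (cosPoly_mem_trigPoly q)
  have hSclosed : IsClosed S := by
    simp only [hS, Set.ofPred_and, Set.ofPred_forall, hE]
    refine ((isClosed_le (by fun_prop) (by fun_prop)).inter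
      (isClosed_le (by fun_prop) (by fun_prop))).inter
      ((isClosed_iInter fun i => isClosed_le (by fun_prop) (by fun_prop)).inter
        (isClosed_iInter fun q => isClosed_le ?_ (by fun_prop)))
    have := hcp q
    fun_prop
  have hSsub : S ⊆ Set.Icc (0 : ℝ) 1 ×ˢ
      Set.Icc (fun i : Fin N => a i - 3 * ρ i) (fun i : Fin N => a i + 3 * ρ i) := by
    rintro ⟨c, θ⟩ ⟨hc, hθ, -⟩
    have : ∀ i : Fin N, |θ i - a i| ≤ 3 * ρ i := fun i =>
      (hθ i).trans (by nlinarith [hρ0 i, hc.1])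
    exact ⟨hc, fun i => by linarith [(abs_le.1 (this i)).1],
      fun i => by linarith [(abs_le.1 (this i)).2]⟩
  have hScomp : IsCompact S := (isCompact_Icc.prod isCompact_Icc).of_isClosed_subset hSclosed hSsub
  have hSne : S.Nonempty :=
    ⟨(1, fun i => a i), ⟨zero_le_one, le_rfl⟩, fun i => by simp, fun q => by simpa using herr q⟩
  obtain ⟨⟨c, θ⟩, ⟨hc, hθ, hEθ⟩, hmin⟩ :=
    hScomp.exists_isMinOn hSne (f := Prod.fst) continuous_fst.continuousOn
  simp only at hc hθ hEθ
  rcases hc.1.eq_or_lt with hc0 | hcpos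
  · refine ⟨θ, fun q => ?_⟩
    have := hEθ q
    rw [← hc0, zero_mul] at this
    exact sub_eq_zero.1 (abs_eq_zero.1 (le_antisymm this (abs_nonneg _)))
  exfalso
  obtain ⟨v, hvρ, hv⟩ := exists_box_solution
    (fun (k : Fin n) (i : Fin N) => (k.1 + 1) * cos (θ i) ^ k.1 * -sin (θ i)) ρ hρ0
    (fun k => -(1 / (2 * c)) * (∑ i, cos (θ i) ^ (k.1 + 1) - m k)) (by
      intro q
      have h1 := trigPoly_sampling hn (trigPoly_deriv_mem hn (cosPoly_mem_trigPoly q)) ha0 haN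
        hmono hstep θ (fun i => (hθ i).trans (by nlinarith [hρ0 i, hc.1]))
      rw [integral_abs_deriv_cosPoly hn] at h1
      simp only [← deriv_cosPoly]
      have h2 : ∑ k, q k * (-(1 / (2 * c)) * (∑ i, cos (θ i) ^ (k.1 + 1) - m k)) =
          -(1 / (2 * c)) * E θ q := by
        simp only [hE, cosPoly]
        rw [Finset.sum_comm, ← Finset.sum_sub_distrib, Finset.mul_sum]
        refine Finset.sum_congr rfl fun k _ => ?_
        rw [← Finset.mul_sum]; ring
      have h3 : -(1 / (2 * c)) * E θ q ≤ V q / 2 := by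
        have h4 := (abs_le.1 (hEθ q)).1
        have h5 : -E θ q / (2 * c) ≤ (c * V q) / (2 * c) := by gcongr; linarith
        calc -(1 / (2 * c)) * E θ q = -E θ q / (2 * c) := by ring
          _ ≤ (c * V q) / (2 * c) := h5
          _ = V q / 2 := by field_simp
      rw [h2]
      refine h3.trans (le_trans ?_ h1)
      simp only [hV]; linarith)
  set R : ℝ := ∑ i, 2 * n ^ 2 * v i ^ 2 with hR
  have hR0 : 0 ≤ R := Finset.sum_nonneg fun i _ => by positivity
  set ε : ℝ := min c (1 / (6 * (R + 1))) with hε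
  have hεpos : 0 < ε := lt_min hcpos (by positivity)
  have hεc : ε ≤ c := min_le_left _ _
  have hεR : ε * R ≤ 1 / 6 := by
    have h1 : ε ≤ 1 / (6 * (R + 1)) := min_le_right _ _
    calc ε * R ≤ 1 / (6 * (R + 1)) * (R + 1) := by gcongr; linarith
      _ = 1 / 6 := by field_simp
  have hmem : ((c - ε / 3, fun i => θ i + ε * v i) : ℝ × (Fin N → ℝ)) ∈ S := by
    refine ⟨⟨by simp only; linarith, by simp only; linarith [hc.2]⟩, fun i => ?_, fun q => ?_⟩
    · have h1 : θ i + ε * v i - a i = (θ i - a i) + ε * v i := by ring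
      have h2 : |ε * v i| ≤ ε * ρ i := by
        rw [abs_mul, abs_of_pos hεpos]; gcongr; exact hvρ i
      simp only [h1]
      refine (abs_add_le _ _).trans ?_
      linarith [hθ i]
    · have hT := cosPoly_mem_trigPoly q
      have hT' := trigPoly_deriv_mem hn hT
      have hM : ∀ x, |deriv (deriv (cosPoly q)) x| ≤ 2 * n ^ 2 * V q := by
        intro x
        refine (abs_deriv_trigPoly_le hn hT' x).trans_eq ?_
        rw [integral_abs_deriv_cosPoly hn]; simp only [hV]; ring
      have hrem := fun i => abs_taylor_le (trigPoly_differentiable hT)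
        (trigPoly_differentiable hT') hM (θ i) (ε * v i)
      have hlin : ∑ i, ε * v i * deriv (cosPoly q) (θ i) = -(ε / (2 * c)) * E θ q := by
        have h1 : ∀ i, ε * v i * deriv (cosPoly q) (θ i) =
            ∑ k : Fin n, ε * (q k * ((k.1 + 1) * cos (θ i) ^ k.1 * -sin (θ i) * v i)) := by
          intro i
          rw [deriv_cosPoly, Finset.mul_sum]
          exact Finset.sum_congr rfl fun k _ => by ring
        simp only [h1]
        rw [Finset.sum_comm]
        simp only [← Finset.mul_sum, hv]
        simp only [hE, cosPoly]
        rw [Finset.sum_comm, ← Finset.sum_sub_distrib, Finset.mul_sum, Finset.mul_sum]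
        refine Finset.sum_congr rfl fun k _ => ?_
        rw [← Finset.mul_sum]; ring
      have hdecomp : E (fun i => θ i + ε * v i) q = (1 - ε / (2 * c)) * E θ q +
          ∑ i, (cosPoly q (θ i + ε * v i) - cosPoly q (θ i) -
            ε * v i * deriv (cosPoly q) (θ i)) := by
        rw [Finset.sum_sub_distrib, Finset.sum_sub_distrib, hlin]
        simp only [hE]; ring
      have hcoef : 0 ≤ 1 - ε / (2 * c) := by
        rw [sub_nonneg, div_le_one (by positivity)]; linarith
      have hsum : |∑ i, (cosPoly q (θ i + ε * v i) - cosPoly q (θ i) -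
            ε * v i * deriv (cosPoly q) (θ i))| ≤ ε ^ 2 * R * V q := by
        refine (Finset.abs_sum_le_sum_abs _ _).trans ((Finset.sum_le_sum fun i _ => hrem i).trans_eq ?_)
        rw [hR, Finset.mul_sum, Finset.sum_mul]
        exact Finset.sum_congr rfl fun i _ => by ring
      simp only [hdecomp]
      refine (abs_add_le _ _).trans ?_
      rw [abs_mul, abs_of_nonneg hcoef]
      have h1 : (1 - ε / (2 * c)) * |E θ q| ≤ (1 - ε / (2 * c)) * (c * V q) := by
        gcongr; exact hEθ q
      have h2 : (1 - ε / (2 * c)) * (c * V q) = (c - ε / 2) * V q := by field_simp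
      have h3 : ε ^ 2 * R * V q ≤ ε / 6 * V q := by
        have : ε ^ 2 * R ≤ ε / 6 := by nlinarith
        exact mul_le_mul_of_nonneg_right this (hV0 q)
      linarith
  have := hmin hmem
  simp only [Set.mem_ofPred_eq] at this
  linarith

/-- Equal-weight quadrature for a density on `[0, π]` giving enough mass to every interval of
length comparable with `1 / n`. -/
lemma exists_nodes_of_density {ω : ℝ → ℝ} (hω : IntervalIntegrable ω volume 0 π)
    (hω0 : ∀ x ∈ Icc 0 π, 0 ≤ ω x) {W : ℝ} (hW : ∫ x in (0 : ℝ)..π, ω x = W) (hWpos : 0 < W)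
    {n N : ℕ} (hn : 1 ≤ n) (hN : 1 ≤ N)
    (hmass : ∀ a b, 0 ≤ a → b ≤ π → 1 / (32 * n) < b - a → W / N < ∫ x in a..b, ω x) :
    ∃ θ : Fin N → ℝ, ∀ p : Polynomial ℝ, p.natDegree ≤ n →
      ∫ x in (0 : ℝ)..π, p.eval (cos x) * ω x = W / N * ∑ i, p.eval (cos (θ i)) := by
  have hN0 : (0 : ℝ) < N := by exact_mod_cast hN
  have hint : ∀ a b, a ∈ Icc 0 π → b ∈ Icc 0 π → IntervalIntegrable ω volume a b :=
    fun a b ha hb => hω.mono_set (by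
      rw [Set.uIcc_of_le pi_pos.le]; exact Set.uIcc_subset_Icc ha hb)
  have h0 : (0 : ℝ) ∈ Icc 0 π := ⟨le_rfl, pi_pos.le⟩
  have hpi : π ∈ Icc 0 π := ⟨pi_pos.le, le_rfl⟩
  set F : ℝ → ℝ := fun x => ∫ t in (0 : ℝ)..x, ω t with hF
  have hFc : ContinuousOn F (Icc 0 π) := by
    have := intervalIntegral.continuousOn_primitive_interval (a := 0) (b := π) (f := ω)
      (μ := volume) (by
        rw [Set.uIcc_of_le pi_pos.le]
        exact (intervalIntegrable_iff_integrableOn_Icc_of_le pi_pos.le).1 hω)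
    rwa [Set.uIcc_of_le pi_pos.le] at this
  have hFsub : ∀ a b, a ∈ Icc 0 π → b ∈ Icc 0 π → ∫ t in a..b, ω t = F b - F a :=
    fun a b ha hb => by
      rw [hF, intervalIntegral.integral_interval_sub_left (hint _ _ h0 hb) (hint _ _ h0 ha)]
  have hnn : ∀ a b, a ∈ Icc 0 π → b ∈ Icc 0 π → a ≤ b → 0 ≤ ∫ t in a..b, ω t :=
    fun a b ha hb hab => intervalIntegral.integral_nonneg hab fun x hx =>
      hω0 x ⟨ha.1.trans hx.1, hx.2.trans hb.2⟩
  have hF0 : F 0 = 0 := by simp [hF]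
  have hFpi : F π = W := hW
  have hex : ∀ i : ℕ, ∃ x ∈ Icc 0 π, i ≤ N → F x = W * i / N ∧ (i = 0 → x = 0) ∧ (i = N → x = π) := by
    intro i
    rcases Nat.eq_zero_or_pos i with rfl | hi
    · exact ⟨0, h0, fun _ => ⟨by simp [hF0], fun _ => rfl, fun h => by omega⟩⟩
    rcases lt_trichotomy i N with hiN | rfl | hiN
    · have hiN' : (i : ℝ) ≤ N := by exact_mod_cast hiN.le
      obtain ⟨x, hx, hxF⟩ := intermediate_value_Icc pi_pos.le hFc
        (show W * i / N ∈ Icc (F 0) (F π) by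
          rw [hF0, hFpi]
          refine ⟨by positivity, ?_⟩
          rw [div_le_iff₀ hN0]; gcongr)
      exact ⟨x, hx, fun _ => ⟨hxF, fun h => by omega, fun h => by omega⟩⟩
    · exact ⟨π, hpi, fun _ => ⟨by rw [hFpi]; field_simp, fun h => by omega, fun _ => rfl⟩⟩
    · exact ⟨0, h0, fun h => by omega⟩
  choose a ha haF using hex
  have hcell : ∀ i < N, ∫ x in a i..a (i + 1), ω x = W / N := by
    intro i hi
    rw [hFsub _ _ (ha _) (ha _), (haF i hi.le).1, (haF (i + 1) hi).1]
    push_cast; field_simp; ring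
  have hmono : ∀ i < N, a i ≤ a (i + 1) := by
    intro i hi
    by_contra! hlt
    have h1 := hnn _ _ (ha _) (ha _) hlt.le
    rw [intervalIntegral.integral_symm, hcell i hi] at h1
    have : 0 < W / N := by positivity
    linarith
  have hstep : ∀ i < N, a (i + 1) - a i ≤ 1 / (32 * n) := by
    intro i hi
    by_contra! hlt
    exact absurd (hcell i hi) (hmass _ _ (ha i).1 (ha (i + 1)).2 hlt).ne'
  have ha0 : a 0 = 0 := (haF 0 (by omega)).2.1 rfl
  have haN : a N = π := (haF N le_rfl).2.2 rfl
  have hcint : ∀ f : ℝ → ℝ, Continuous f → ∀ x y, x ∈ Icc 0 π → y ∈ Icc 0 π →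
      IntervalIntegrable (fun t => f t * ω t) volume x y := fun f hf x y hx hy =>
    (hint x y hx hy).continuousOn_mul hf.continuousOn
  set m : Fin n → ℝ := fun k => N / W * ∫ x in (0 : ℝ)..π, cos x ^ (k.1 + 1) * ω x with hm
  have hmq : ∀ q : Fin n → ℝ, ∑ k, q k * m k = N / W * ∫ x in (0 : ℝ)..π, cosPoly q x * ω x := by
    intro q
    simp only [cosPoly, Finset.sum_mul]
    rw [intervalIntegral.integral_finsetSum, Finset.mul_sum]
    · refine Finset.sum_congr rfl fun k _ => ?_
      simp only [hm, mul_assoc]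
      rw [intervalIntegral.integral_const_mul]; ring
    · intro k _
      exact hcint (fun x => q k * cos x ^ (k.1 + 1)) (by fun_prop) _ _ h0 hpi
  obtain ⟨θ, hθ⟩ := exists_nodes_of_partition hn ha0 haN hmono hstep m (by
    intro q
    have hT := cosPoly_mem_trigPoly q
    have hTc := trigPoly_continuous hT
    have hTc' := trigPoly_continuous (trigPoly_deriv_mem hn hT)
    have hi' : ∀ x y, IntervalIntegrable (fun t => |deriv (cosPoly q) t|) volume x y :=
      fun x y => hTc'.abs.intervalIntegrable x y
    rw [hmq]
    have hs1 : ∫ x in (0 : ℝ)..π, cosPoly q x * ω x =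
        ∑ i : Fin N, ∫ x in a i..a (i + 1), cosPoly q x * ω x := by
      rw [← Finset.sum_range fun i => ∫ x in a i..a (i + 1), cosPoly q x * ω x,
        intervalIntegral.sum_integral_adjacent_intervals, ha0, haN]
      exact fun k _ => hcint _ hTc _ _ (ha _) (ha _)
    have hs2 : ∫ x in (0 : ℝ)..π, |deriv (cosPoly q) x| =
        ∑ i : Fin N, ∫ x in a i..a (i + 1), |deriv (cosPoly q) x| := by
      rw [← Finset.sum_range fun i => ∫ x in a i..a (i + 1), |deriv (cosPoly q) x|,
        intervalIntegral.sum_integral_adjacent_intervals fun k _ => hi' _ _, ha0, haN]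
    rw [hs1, hs2, Finset.mul_sum, ← Finset.sum_sub_distrib]
    refine (Finset.abs_sum_le_sum_abs _ _).trans (Finset.sum_le_sum fun i _ => ?_)
    set D := ∫ x in a i..a (i + 1), |deriv (cosPoly q) x| with hD
    have hle := hmono i i.2
    have hwi := hint _ _ (ha i) (ha (i + 1))
    have e1 : cosPoly q (a i) - N / W * ∫ x in a i..a (i + 1), cosPoly q x * ω x =
        N / W * ∫ x in a i..a (i + 1), (cosPoly q (a i) - cosPoly q x) * ω x := by
      simp only [sub_mul]
      rw [intervalIntegral.integral_sub (hwi.const_mul _) (hcint _ hTc _ _ (ha _) (ha _)),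
        intervalIntegral.integral_const_mul, hcell i i.2]
      field_simp
    have e2 : |∫ x in a i..a (i + 1), (cosPoly q (a i) - cosPoly q x) * ω x| ≤ D * (W / N) := by
      rw [← hcell i i.2, ← intervalIntegral.integral_const_mul]
      refine (intervalIntegral.abs_integral_le_integral_abs hle).trans ?_
      refine intervalIntegral.integral_mono_on hle
        (hcint (fun x => cosPoly q (a i) - cosPoly q x) (by fun_prop) _ _ (ha _) (ha _)).abs
        (hwi.const_mul _) fun x hx => ?_
      have hwx := hω0 x ⟨(ha i).1.trans hx.1, hx.2.trans (ha (i + 1)).2⟩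
      rw [abs_mul, abs_of_nonneg hwx]
      refine mul_le_mul_of_nonneg_right ?_ hwx
      rw [abs_sub_comm, ← intervalIntegral.integral_deriv_eq_sub
        (fun y _ => trigPoly_differentiable hT y) (hTc'.intervalIntegrable _ _)]
      refine (intervalIntegral.abs_integral_le_integral_abs hx.1).trans ?_
      exact intervalIntegral.integral_mono_interval le_rfl hx.1 hx.2
        (Filter.Eventually.of_forall fun _ => abs_nonneg _) (hi' _ _)
    rw [e1, abs_mul, abs_of_pos (by positivity)]
    calc N / W * |∫ x in a i..a (i + 1), (cosPoly q (a i) - cosPoly q x) * ω x|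
        ≤ N / W * (D * (W / N)) := by gcongr
      _ = D := by field_simp)
  refine ⟨θ, fun p hp => ?_⟩
  set q : Fin n → ℝ := fun k => p.coeff (k.1 + 1) with hq
  have hpq : ∀ x, p.eval (cos x) = p.coeff 0 + cosPoly q x := by
    intro x
    rw [Polynomial.eval_eq_sum_range' (Nat.lt_succ_of_le hp), Finset.sum_range_succ', pow_zero,
      mul_one, add_comm, Finset.sum_range]
    rfl
  simp only [hpq, add_mul]
  rw [intervalIntegral.integral_add (hω.const_mul _)
    (hcint _ (trigPoly_continuous (cosPoly_mem_trigPoly q)) _ _ h0 hpi),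
    intervalIntegral.integral_const_mul, hW, Finset.sum_add_distrib, hθ q, hmq]
  simp only [Finset.sum_const, Finset.card_univ, Fintype.card_fin, nsmul_eq_mul]
  field_simp

/-! ### Products of powers of distances -/

lemma exists_pos_forall_le {κ : Type*} [Finite κ] (f : κ → ℝ) (hf : ∀ k, 0 < f k) :
    ∃ ε > 0, ∀ k, ε ≤ f k := by
  cases isEmpty_or_nonempty κ
  · exact ⟨1, one_pos, fun k => isEmptyElim k⟩
  · obtain ⟨k, hk⟩ := Finite.exists_min f
    exact ⟨f k, hf k, hk⟩

lemma exists_separation {ι : Type*} [Finite ι] {ζ : ι → ℝ} (hζ : Function.Injective ζ) :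
    ∃ d > 0, d ≤ 1 ∧ ∀ θ i j, i ≠ j → |θ - ζ i| ≤ d → d ≤ |θ - ζ j| := by
  obtain ⟨ε, hε, h⟩ := exists_pos_forall_le
    (fun p : {p : ι × ι // p.1 ≠ p.2} => |ζ p.1.1 - ζ p.1.2|)
    (fun p => abs_pos.2 (sub_ne_zero.2 fun h => p.2 (hζ h)))
  refine ⟨min (ε / 2) 1, by positivity, min_le_right _ _, fun θ i j hij hi => ?_⟩
  have h1 := h ⟨(i, j), hij⟩
  have h2 : |ζ i - ζ j| ≤ |θ - ζ i| + |θ - ζ j| := by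
    rw [abs_sub_comm θ (ζ i)]; exact abs_sub_le _ _ _
  have h3 := min_le_left (ε / 2) 1
  simp only at h1
  linarith

lemma exists_prod_rpow_bounds {ι : Type*} [Fintype ι] (e : ι → ℝ) {d D : ℝ} (hd : 0 < d) :
    ∃ Λ > 0, ∀ (S : Finset ι) (y : ι → ℝ), (∀ i ∈ S, d ≤ y i ∧ y i ≤ D) →
      exp (-Λ) ≤ ∏ i ∈ S, y i ^ e i ∧ ∏ i ∈ S, y i ^ e i ≤ exp Λ := by
  refine ⟨∑ i, |e i| * (|log d| + |log D|) + 1, by positivity, fun S y hy => ?_⟩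
  have hpos : ∀ i ∈ S, 0 < y i := fun i hi => hd.trans_le (hy i hi).1
  have hprod : ∏ i ∈ S, y i ^ e i = exp (∑ i ∈ S, e i * log (y i)) := by
    rw [exp_sum]
    refine Finset.prod_congr rfl fun i hi => ?_
    rw [rpow_def_of_pos (hpos i hi), mul_comm]
  have hsum : |∑ i ∈ S, e i * log (y i)| ≤ ∑ i, |e i| * (|log d| + |log D|) + 1 := by
    calc |∑ i ∈ S, e i * log (y i)| ≤ ∑ i ∈ S, |e i * log (y i)| := Finset.abs_sum_le_sum_abs _ _
      _ ≤ ∑ i ∈ S, |e i| * (|log d| + |log D|) := by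
        refine Finset.sum_le_sum fun i hi => ?_
        rw [abs_mul]
        have h1 := log_le_log hd (hy i hi).1
        have h2 := log_le_log (hpos i hi) (hy i hi).2
        have : |log (y i)| ≤ |log d| + |log D| := abs_le.2
          ⟨by linarith [neg_abs_le (log d), abs_nonneg (log D)],
            by linarith [le_abs_self (log D), abs_nonneg (log d)]⟩
        gcongr
      _ ≤ ∑ i, |e i| * (|log d| + |log D|) :=
        Finset.sum_le_sum_of_subset_of_nonneg (Finset.subset_univ _)
          fun i _ _ => by positivity
      _ ≤ _ := by linarith
  rw [hprod]
  exact ⟨exp_le_exp.2 (abs_le.1 hsum).1, exp_le_exp.2 (abs_le.1 hsum).2⟩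

/-- Near a singularity, and away from all of them, the product of powers of distances is
comparable with its only relevant factor. -/
lemma exists_local_bounds {ι : Type*} [Fintype ι] {ζ : ι → ℝ} (hζ : Function.Injective ζ)
    (hζI : ∀ j, ζ j ∈ Icc 0 π) (e : ι → ℝ) :
    ∃ d > 0, d ≤ 1 ∧ ∃ Λ > 0, ∀ θ ∈ Icc 0 π,
      (∀ j, |θ - ζ j| ≤ d → exp (-Λ) * |θ - ζ j| ^ e j ≤ ∏ i, |θ - ζ i| ^ e i ∧
        ∏ i, |θ - ζ i| ^ e i ≤ exp Λ * |θ - ζ j| ^ e j) ∧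
      ((∀ j, d < |θ - ζ j|) → exp (-Λ) ≤ ∏ i, |θ - ζ i| ^ e i ∧
        ∏ i, |θ - ζ i| ^ e i ≤ exp Λ) := by
  classical
  obtain ⟨d, hd, hd1, hsep⟩ := exists_separation hζ
  obtain ⟨Λ, hΛ, hb⟩ := exists_prod_rpow_bounds e (D := π) hd
  refine ⟨d, hd, hd1, Λ, hΛ, fun θ hθ => ⟨fun j hj => ?_, fun hj => ?_⟩⟩
  · have h := hb (Finset.univ.erase j) (fun i => |θ - ζ i|) fun i hi =>
      ⟨hsep θ j i (Finset.ne_of_mem_erase hi).symm hj,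
        abs_le.2 ⟨by linarith [hθ.1, (hζI i).2], by linarith [hθ.2, (hζI i).1]⟩⟩
    rw [← Finset.prod_erase_mul _ _ (Finset.mem_univ j)]
    exact ⟨mul_le_mul_of_nonneg_right h.1 (by positivity),
      mul_le_mul_of_nonneg_right h.2 (by positivity)⟩
  · exact hb Finset.univ (fun i => |θ - ζ i|) fun i _ => ⟨(hj i).le,
      abs_le.2 ⟨by linarith [hθ.1, (hζI i).2], by linarith [hθ.2, (hζI i).1]⟩⟩

lemma exists_subinterval_avoiding {ι : Type*} (ζ : ι → ℝ) (S : Finset ι) :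
    ∃ c > 0, ∀ a b, a < b → ∃ a', a ≤ a' ∧ a' + c * (b - a) ≤ b ∧
      ∀ θ ∈ Icc a' (a' + c * (b - a)), ∀ j ∈ S, c * (b - a) ≤ |θ - ζ j| := by
  classical
  induction S using Finset.induction_on with
  | empty => exact ⟨1, one_pos, fun a b _ => ⟨a, le_rfl, by linarith, by simp⟩⟩
  | insert i S hi ih =>
    obtain ⟨c, hc, h⟩ := ih
    refine ⟨c / 6, by positivity, fun a b hab => ?_⟩
    obtain ⟨a', h1, h2, h3⟩ := h a b hab
    have hpos : 0 < c * (b - a) := mul_pos hc (by linarith)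
    set r := c * (b - a) with hr
    have hr6 : c / 6 * (b - a) = r / 6 := by rw [hr]; ring
    rw [hr6]
    rcases le_total (ζ i) (a' + r / 2) with hz | hz
    · refine ⟨a' + 5 * r / 6, by linarith, by linarith, fun θ hθ j hj => ?_⟩
      rcases Finset.mem_insert.1 hj with rfl | hj
      · exact le_trans (by linarith [hθ.1]) (le_abs_self _)
      · exact le_trans (by linarith) (h3 θ ⟨by linarith [hθ.1], by linarith [hθ.2]⟩ j hj)
    · refine ⟨a', by linarith, by linarith, fun θ hθ j hj => ?_⟩
      rcases Finset.mem_insert.1 hj with rfl | hj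
      · exact le_trans (by linarith [hθ.2]) (neg_le_abs _)
      · exact le_trans (by linarith) (h3 θ ⟨by linarith [hθ.1], by linarith [hθ.2]⟩ j hj)

lemma intervalIntegrable_abs_sub_rpow {e : ℝ} (he : -1 < e) (z a b : ℝ) :
    IntervalIntegrable (fun x => |x - z| ^ e) volume a b := by
  have hpos : ∀ b : ℝ, 0 ≤ b → IntervalIntegrable (fun x : ℝ => |x| ^ e) volume 0 b := by
    intro b hb
    refine (intervalIntegral.intervalIntegrable_rpow' he).congr (fun x hx => ?_)
    rw [uIoc_of_le hb] at hx
    simp only [abs_of_pos hx.1]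
  have hall : ∀ b : ℝ, IntervalIntegrable (fun x : ℝ => |x| ^ e) volume 0 b := by
    intro b
    rcases le_total 0 b with hb | hb
    · exact hpos b hb
    · have := (IntervalIntegrable.iff_comp_neg (by simp)).1 (hpos (-b) (by linarith))
      simpa using this
  have := ((hall (a - z)).symm.trans (hall (b - z))).comp_sub_right z
  simpa using this

lemma integral_abs_sub_rpow_right {e : ℝ} (he : -1 < e) (z : ℝ) {ρ : ℝ} (hρ : 0 ≤ ρ) :
    ∫ x in z..z + ρ, |x - z| ^ e = ρ ^ (e + 1) / (e + 1) := by
  rw [intervalIntegral.integral_comp_sub_right (fun x => |x| ^ e) z]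
  have : ∫ x in z - z..z + ρ - z, |x| ^ e = ∫ x in (0:ℝ)..ρ, x ^ e := by
    rw [sub_self, add_sub_cancel_left]
    refine intervalIntegral.integral_congr fun x hx => ?_
    rw [uIcc_of_le hρ] at hx
    simp only [abs_of_nonneg hx.1]
  rw [this, integral_rpow (Or.inl he), zero_rpow (by linarith), sub_zero]

lemma integral_abs_sub_rpow_left {e : ℝ} (he : -1 < e) (z : ℝ) {ρ : ℝ} (hρ : 0 ≤ ρ) :
    ∫ x in z - ρ..z, |x - z| ^ e = ρ ^ (e + 1) / (e + 1) := by
  rw [← integral_abs_sub_rpow_right he z hρ]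
  have := intervalIntegral.integral_comp_sub_left (fun x => |x - z| ^ e) (2 * z) (a := z) (b := z + ρ)
  rw [show 2 * z - (z + ρ) = z - ρ by ring, show 2 * z - z = z by ring] at this
  rw [← this]
  congr 1; ext x
  rw [show 2 * z - x - z = -(x - z) by ring, abs_neg]

/-! ### Densities comparable with products of powers of distances -/

lemma intervalIntegrable_of_le_prod {ι : Type*} [Fintype ι] {ζ e : ι → ℝ}
    (hζ : Function.Injective ζ) (hζI : ∀ j, ζ j ∈ Icc 0 π) (he : ∀ j, -1 < e j)
    {ω : ℝ → ℝ} (hω : Measurable ω) {M : ℝ}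
    (h0 : ∀ θ ∈ Icc 0 π, 0 ≤ ω θ) (hM : ∀ θ ∈ Icc 0 π, ω θ ≤ M * ∏ i, |θ - ζ i| ^ e i) :
    IntervalIntegrable ω volume 0 π := by
  obtain ⟨d, hd, -, Λ, hΛ, hloc⟩ := exists_local_bounds hζ hζI e
  have hint : IntervalIntegrable (fun θ => |M| * (exp Λ + ∑ j, exp Λ * |θ - ζ j| ^ e j))
      volume 0 π := by
    refine IntervalIntegrable.const_mul ?_ _
    refine intervalIntegrable_const.add ?_
    have := IntervalIntegrable.sum (μ := volume) (a := 0) (b := π) Finset.univ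
      (f := fun j θ => exp Λ * |θ - ζ j| ^ e j)
      (fun j _ => (intervalIntegrable_abs_sub_rpow (he j) (ζ j) 0 π).const_mul _)
    refine this.congr (fun x _ => ?_)
    simp
  refine hint.mono_fun' hω.aestronglyMeasurable ?_
  rw [uIoc_of_le pi_nonneg]
  refine (ae_restrict_iff' measurableSet_Ioc).2 (Filter.Eventually.of_forall fun θ hθ => ?_)
  have hθ' := Ioc_subset_Icc_self hθ
  simp only [norm_eq_abs, abs_of_nonneg (h0 θ hθ')]
  have hP0 : 0 ≤ ∏ i, |θ - ζ i| ^ e i := Finset.prod_nonneg fun i _ => by positivity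
  refine (hM θ hθ').trans ?_
  refine mul_le_mul (le_abs_self M) ?_ hP0 (abs_nonneg _)
  have hs0 : ∀ j, 0 ≤ exp Λ * |θ - ζ j| ^ e j := fun j => by positivity
  by_cases hj : ∃ j, |θ - ζ j| ≤ d
  · obtain ⟨j, hj⟩ := hj
    have h1 := ((hloc θ hθ').1 j hj).2
    have h2 := Finset.single_le_sum (f := fun j => exp Λ * |θ - ζ j| ^ e j)
      (fun i _ => hs0 i) (Finset.mem_univ j)
    linarith [exp_pos Λ]
  · push Not at hj
    have h1 := ((hloc θ hθ').2 hj).2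
    linarith [Finset.sum_nonneg fun j (_ : j ∈ Finset.univ) => hs0 j]

lemma exists_arc_mass_lower {ι : Type*} [Fintype ι] {ζ e : ι → ℝ}
    (hζ : Function.Injective ζ) (hζI : ∀ j, ζ j ∈ Icc 0 π)
    {ω : ℝ → ℝ} (hωi : IntervalIntegrable ω volume 0 π) {m : ℝ} (hm : 0 < m)
    (hlow : ∀ θ ∈ Icc 0 π, m * ∏ i, |θ - ζ i| ^ e i ≤ ω θ)
    {κ : ℝ} (hκ1 : 1 ≤ κ) (hκ : ∀ j, e j + 1 ≤ κ) :
    ∃ c > 0, ∀ a b, 0 ≤ a → a < b → b ≤ π → c * (b - a) ^ κ ≤ ∫ θ in a..b, ω θ := by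
  obtain ⟨d, hd, -, Λ, hΛ, hloc⟩ := exists_local_bounds hζ hζI e
  obtain ⟨c, hc, hsub⟩ := exists_subinterval_avoiding ζ Finset.univ
  obtain ⟨η, hη, hηj⟩ := exists_pos_forall_le (fun j => π ^ (e j - (κ - 1)))
    fun j => rpow_pos_of_pos pi_pos _
  have h0 : ∀ θ ∈ Icc 0 π, 0 ≤ ω θ := fun θ hθ => le_trans
    (mul_nonneg hm.le (Finset.prod_nonneg fun i _ => by positivity)) (hlow θ hθ)
  -- pointwise lower bound at distance `δ` from the singularities
  set ν := min η (π ^ (-(κ - 1))) with hν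
  have hνpos : 0 < ν := lt_min hη (rpow_pos_of_pos pi_pos _)
  have hpt : ∀ θ ∈ Icc 0 π, ∀ δ, 0 < δ → δ ≤ π → (∀ j, δ ≤ |θ - ζ j|) →
      m * (exp (-Λ) * (ν * δ ^ (κ - 1))) ≤ ω θ := by
    intro θ hθ δ hδ hδπ hj
    refine le_trans (mul_le_mul_of_nonneg_left ?_ hm.le) (hlow θ hθ)
    by_cases hjd : ∃ j, |θ - ζ j| ≤ d
    · obtain ⟨j, hjd⟩ := hjd
      refine le_trans (mul_le_mul_of_nonneg_left ?_ (exp_pos _).le) ((hloc θ hθ).1 j hjd).1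
      have hy : 0 < |θ - ζ j| := hδ.trans_le (hj j)
      have hyπ : |θ - ζ j| ≤ π :=
        abs_le.2 ⟨by linarith [hθ.1, (hζI j).2], by linarith [hθ.2, (hζI j).1]⟩
      calc ν * δ ^ (κ - 1) ≤ π ^ (e j - (κ - 1)) * |θ - ζ j| ^ (κ - 1) := by
            refine mul_le_mul ((min_le_left _ _).trans (hηj j)) ?_ (by positivity) (by positivity)
            exact rpow_le_rpow hδ.le (hj j) (by linarith)
        _ ≤ |θ - ζ j| ^ (e j - (κ - 1)) * |θ - ζ j| ^ (κ - 1) := by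
            refine mul_le_mul_of_nonneg_right ?_ (by positivity)
            exact rpow_le_rpow_of_nonpos hy hyπ (by linarith [hκ j])
        _ = |θ - ζ j| ^ e j := by rw [← rpow_add hy]; ring_nf
    · push Not at hjd
      refine le_trans ?_ ((hloc θ hθ).2 hjd).1
      refine mul_le_of_le_one_right (exp_pos _).le ?_
      calc ν * δ ^ (κ - 1) ≤ π ^ (-(κ - 1)) * π ^ (κ - 1) :=
            mul_le_mul (min_le_right _ _) (rpow_le_rpow hδ.le hδπ (by linarith))
              (by positivity) (by positivity)
        _ = 1 := by rw [← rpow_add pi_pos]; simp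
  refine ⟨m * (exp (-Λ) * (ν * min c 1 ^ (κ - 1))) * c, by positivity, fun a b ha hab hb => ?_⟩
  obtain ⟨a', h1, h2, h3⟩ := hsub a b hab
  have hba : 0 < b - a := by linarith
  have hcpos : 0 < c * (b - a) := by positivity
  have hδ : min c 1 * (b - a) ≤ c * (b - a) :=
    mul_le_mul_of_nonneg_right (min_le_left _ _) hba.le
  have hδ' : min c 1 * (b - a) ≤ 1 * (b - a) :=
    mul_le_mul_of_nonneg_right (min_le_right _ _) hba.le
  have hmono : IntervalIntegrable ω volume a b := hωi.mono_set (by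
    rw [uIcc_of_le hab.le, uIcc_of_le pi_nonneg]; exact Icc_subset_Icc ha hb)
  have hmono' : IntervalIntegrable ω volume a' (a' + c * (b - a)) := hωi.mono_set (by
    rw [uIcc_of_le (by linarith), uIcc_of_le pi_nonneg]
    exact Icc_subset_Icc (by linarith) (by linarith))
  calc m * (exp (-Λ) * (ν * min c 1 ^ (κ - 1))) * c * (b - a) ^ κ
      = ∫ θ in a'..(a' + c * (b - a)),
          m * (exp (-Λ) * (ν * (min c 1 * (b - a)) ^ (κ - 1))) := by
        rw [intervalIntegral.integral_const, mul_rpow (by positivity) hba.le]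
        have : (b - a) ^ κ = (b - a) ^ (κ - 1) * (b - a) := by
          conv_rhs => rw [← rpow_add_one hba.ne']
          simp
        rw [this, smul_eq_mul]; ring
    _ ≤ ∫ θ in a'..(a' + c * (b - a)), ω θ := by
        refine intervalIntegral.integral_mono_on (by linarith) intervalIntegrable_const hmono'
          fun θ hθ => hpt θ ⟨by linarith [hθ.1], by linarith [hθ.2]⟩ _ (by positivity)
            (by linarith) fun j => hδ.trans (h3 θ hθ j (Finset.mem_univ j))
    _ ≤ ∫ θ in a..b, ω θ := by
        refine intervalIntegral.integral_mono_interval h1 (by linarith) h2 ?_ hmono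
        refine (ae_restrict_iff' measurableSet_Ioc).2 (Filter.Eventually.of_forall fun θ hθ => ?_)
        exact h0 θ ⟨by linarith [hθ.1], by linarith [hθ.2]⟩

lemma measurableSet_arc (ζ ρ : ℝ) : MeasurableSet {θ ∈ Icc 0 π | |θ - ζ| ≤ ρ} :=
  measurableSet_Icc.inter (measurableSet_le (f := fun θ => |θ - ζ|) (by fun_prop) measurable_const)

lemma exists_ball_mass_upper {ι : Type*} [Fintype ι] {ζ e : ι → ℝ}
    (hζ : Function.Injective ζ) (hζI : ∀ j, ζ j ∈ Icc 0 π) (he : ∀ j, -1 < e j)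
    {ω : ℝ → ℝ} (hωi : IntervalIntegrable ω volume 0 π) {M : ℝ} (hM0 : 0 < M)
    (h0 : ∀ θ ∈ Icc 0 π, 0 ≤ ω θ) (hM : ∀ θ ∈ Icc 0 π, ω θ ≤ M * ∏ i, |θ - ζ i| ^ e i)
    (j : ι) :
    ∃ C > 0, ∀ ρ > 0, ∫ θ in {θ ∈ Icc 0 π | |θ - ζ j| ≤ ρ}, ω θ ≤ C * ρ ^ (e j + 1) := by
  obtain ⟨d, hd, -, Λ, hΛ, hloc⟩ := exists_local_bounds hζ hζI e
  have hE : 0 < e j + 1 := by linarith [he j]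
  have hon : IntegrableOn ω (Icc 0 π) :=
    (intervalIntegrable_iff_integrableOn_Icc_of_le pi_nonneg).1 hωi
  set I := ∫ θ in Icc 0 π, ω θ
  have hI : 0 ≤ I := setIntegral_nonneg measurableSet_Icc h0
  refine ⟨M * exp Λ * (2 / (e j + 1)) + I / d ^ (e j + 1), by positivity, fun ρ hρ => ?_⟩
  have hsub : {θ ∈ Icc 0 π | |θ - ζ j| ≤ ρ} ⊆ Icc 0 π := fun θ hθ => hθ.1
  rw [add_mul]
  have hp1 : 0 ≤ M * exp Λ * (2 / (e j + 1)) * ρ ^ (e j + 1) := by positivity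
  have hp2 : 0 ≤ I / d ^ (e j + 1) * ρ ^ (e j + 1) := by positivity
  rcases le_total ρ d with hρd | hρd
  · refine le_trans ?_ (le_add_of_nonneg_right hp2)
    have hint : IntervalIntegrable (fun θ => M * exp Λ * |θ - ζ j| ^ e j) volume
        (ζ j - ρ) (ζ j + ρ) := (intervalIntegrable_abs_sub_rpow (he j) _ _ _).const_mul _
    have hint' := (intervalIntegrable_iff_integrableOn_Icc_of_le (by linarith)).1 hint
    have hsub' : {θ ∈ Icc 0 π | |θ - ζ j| ≤ ρ} ⊆ Icc (ζ j - ρ) (ζ j + ρ) := fun θ hθ => by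
      have := abs_le.1 hθ.2
      exact ⟨by linarith, by linarith⟩
    calc ∫ θ in {θ ∈ Icc 0 π | |θ - ζ j| ≤ ρ}, ω θ
        ≤ ∫ θ in {θ ∈ Icc 0 π | |θ - ζ j| ≤ ρ}, M * exp Λ * |θ - ζ j| ^ e j := by
          refine setIntegral_mono_on (hon.mono_set hsub) (hint'.mono_set hsub')
            (measurableSet_arc _ _) fun θ hθ => (hM θ hθ.1).trans ?_
          rw [mul_assoc]
          exact mul_le_mul_of_nonneg_left ((hloc θ hθ.1).1 j (hθ.2.trans hρd)).2 hM0.le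
      _ ≤ ∫ θ in Icc (ζ j - ρ) (ζ j + ρ), M * exp Λ * |θ - ζ j| ^ e j := by
          refine setIntegral_mono_set hint' ?_ hsub'.eventuallyLE
          exact Filter.Eventually.of_forall fun θ => by
            simp only [Pi.zero_apply]; positivity
      _ = M * exp Λ * (2 / (e j + 1)) * ρ ^ (e j + 1) := by
          rw [integral_Icc_eq_integral_Ioc, ← intervalIntegral.integral_of_le (by linarith),
            intervalIntegral.integral_const_mul,
            ← intervalIntegral.integral_add_adjacent_intervals (b := ζ j)
              (intervalIntegrable_abs_sub_rpow (he j) _ _ _)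
              (intervalIntegrable_abs_sub_rpow (he j) _ _ _),
            integral_abs_sub_rpow_left (he j) _ hρ.le, integral_abs_sub_rpow_right (he j) _ hρ.le]
          ring
  · refine le_trans ?_ (le_add_of_nonneg_left hp1)
    calc ∫ θ in {θ ∈ Icc 0 π | |θ - ζ j| ≤ ρ}, ω θ ≤ I := by
          refine setIntegral_mono_set hon ?_ hsub.eventuallyLE
          exact (ae_restrict_iff' measurableSet_Icc).2 (Filter.Eventually.of_forall h0)
      _ = I / d ^ (e j + 1) * d ^ (e j + 1) := by
          rw [div_mul_cancel₀]; positivity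
      _ ≤ I / d ^ (e j + 1) * ρ ^ (e j + 1) := by
          refine mul_le_mul_of_nonneg_left ?_ (by positivity)
          exact rpow_le_rpow hd.le hρd hE.le

lemma exists_ball_mass_lower {ι : Type*} [Fintype ι] {ζ e : ι → ℝ}
    (hζ : Function.Injective ζ) (hζI : ∀ j, ζ j ∈ Icc 0 π) (he : ∀ j, -1 < e j)
    {ω : ℝ → ℝ} (hωi : IntervalIntegrable ω volume 0 π) {m : ℝ} (hm : 0 < m)
    (hlow : ∀ θ ∈ Icc 0 π, m * ∏ i, |θ - ζ i| ^ e i ≤ ω θ) (j : ι) :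
    ∃ c > 0, ∀ ρ, 0 < ρ → ρ ≤ 1 →
      c * ρ ^ (e j + 1) ≤ ∫ θ in {θ ∈ Icc 0 π | |θ - ζ j| ≤ ρ}, ω θ := by
  obtain ⟨d, hd, hd1, Λ, hΛ, hloc⟩ := exists_local_bounds hζ hζI e
  have hE : 0 < e j + 1 := by linarith [he j]
  have hon : IntegrableOn ω (Icc 0 π) :=
    (intervalIntegrable_iff_integrableOn_Icc_of_le pi_nonneg).1 hωi
  have h0 : ∀ θ ∈ Icc 0 π, 0 ≤ ω θ := fun θ hθ => le_trans
    (mul_nonneg hm.le (Finset.prod_nonneg fun i _ => by positivity)) (hlow θ hθ)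
  refine ⟨m * exp (-Λ) * (d ^ (e j + 1) / (e j + 1)), by positivity, fun ρ hρ hρ1 => ?_⟩
  have hr : 0 < d * ρ := by positivity
  have hrd : d * ρ ≤ d := mul_le_of_le_one_right hd.le hρ1
  have hrρ : d * ρ ≤ ρ := mul_le_of_le_one_left hρ.le hd1
  have hpi := pi_gt_three
  have key : ∀ a b, a ≤ b → 0 ≤ a → b ≤ π → (∀ θ ∈ Icc a b, |θ - ζ j| ≤ d * ρ) →
      ∫ θ in a..b, |θ - ζ j| ^ e j = (d * ρ) ^ (e j + 1) / (e j + 1) →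
      m * exp (-Λ) * (d ^ (e j + 1) / (e j + 1)) * ρ ^ (e j + 1) ≤
        ∫ θ in {θ ∈ Icc 0 π | |θ - ζ j| ≤ ρ}, ω θ := by
    intro a b hab ha hb hnear hval
    have hsub : Icc a b ⊆ {θ ∈ Icc 0 π | |θ - ζ j| ≤ ρ} := fun θ hθ =>
      ⟨⟨ha.trans hθ.1, hθ.2.trans hb⟩, (hnear θ hθ).trans hrρ⟩
    calc m * exp (-Λ) * (d ^ (e j + 1) / (e j + 1)) * ρ ^ (e j + 1)
        = ∫ θ in a..b, m * exp (-Λ) * |θ - ζ j| ^ e j := by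
          rw [intervalIntegral.integral_const_mul, hval, mul_rpow hd.le hρ.le]; ring
      _ = ∫ θ in Icc a b, m * exp (-Λ) * |θ - ζ j| ^ e j := by
          rw [integral_Icc_eq_integral_Ioc, intervalIntegral.integral_of_le hab]
      _ ≤ ∫ θ in Icc a b, ω θ := by
          refine setIntegral_mono_on ?_ (hon.mono_set (Icc_subset_Icc ha hb)) measurableSet_Icc ?_
          · exact (intervalIntegrable_iff_integrableOn_Icc_of_le hab).1
              ((intervalIntegrable_abs_sub_rpow (he j) _ _ _).const_mul _)
          · intro θ hθ
            have hθ' := (hsub hθ).1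
            refine le_trans ?_ (hlow θ hθ')
            rw [mul_assoc]
            exact mul_le_mul_of_nonneg_left
              ((hloc θ hθ').1 j ((hnear θ hθ).trans hrd)).1 hm.le
      _ ≤ _ := by
          refine setIntegral_mono_set (hon.mono_set fun θ hθ => hθ.1) ?_ hsub.eventuallyLE
          exact (ae_restrict_iff' (measurableSet_arc _ _)).2
            (Filter.Eventually.of_forall fun θ hθ => h0 θ hθ.1)
  rcases le_total (ζ j) (π / 2) with hz | hz
  · refine key (ζ j) (ζ j + d * ρ) (by linarith) (hζI j).1 (by linarith) (fun θ hθ => ?_)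
      (integral_abs_sub_rpow_right (he j) _ hr.le)
    exact abs_le.2 ⟨by linarith [hθ.1], by linarith [hθ.2]⟩
  · refine key (ζ j - d * ρ) (ζ j) (by linarith) (by linarith) (hζI j).2 (fun θ hθ => ?_)
      (integral_abs_sub_rpow_left (he j) _ hr.le)
    exact abs_le.2 ⟨by linarith [hθ.1], by linarith [hθ.2]⟩

/-! ### Lower bounds for the number of nodes -/

lemma abs_sin_natCast_mul_le (m : ℕ) (ψ : ℝ) : |sin (m * ψ)| ≤ m * |sin ψ| := by
  induction m with
  | zero => simp
  | succ m ih =>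
    push_cast
    rw [add_mul, one_mul, sin_add, add_mul, one_mul]
    refine (abs_add_le _ _).trans (add_le_add ?_ ?_)
    · rw [abs_mul]
      exact (mul_le_of_le_one_right (abs_nonneg _) (abs_cos_le_one _)).trans ih
    · rw [abs_mul]
      exact mul_le_of_le_one_left (abs_nonneg _) (abs_cos_le_one _)

/-- A Fejér-type kernel: a polynomial of degree less than `m` with the values
`(sin (m ψ) / (m sin ψ)) ^ 2` at `sin ψ ^ 2`. -/
lemma exists_fejer_polynomial {m : ℕ} (hm : 1 ≤ m) :
    ∃ G : Polynomial ℝ, G.natDegree ≤ m - 1 ∧ ∀ u ∈ Icc (0:ℝ) 1, 0 ≤ G.eval u ∧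
      G.eval u ≤ 1 ∧ (m:ℝ) ^ 2 * u * G.eval u ≤ 1 ∧
      ((m:ℝ) ^ 2 * u ≤ 1 → 4 / π ^ 2 ≤ G.eval u) := by
  have hm0 : (0:ℝ) < m := by exact_mod_cast hm
  set Q : Polynomial ℝ := 1 - (Polynomial.Chebyshev.T ℝ m).comp (1 - 2 * Polynomial.X) with hQ
  have hQeval : ∀ ψ, Q.eval (sin ψ ^ 2) = 2 * sin (m * ψ) ^ 2 := by
    intro ψ
    have h1 : (1:ℝ) - 2 * sin ψ ^ 2 = cos (2 * ψ) := by rw [cos_two_mul, cos_sq']; ring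
    have h2 := Polynomial.Chebyshev.T_real_cos (2 * ψ) (m : ℤ)
    have h3 : Q.eval (sin ψ ^ 2) = 1 - (Polynomial.Chebyshev.T ℝ m).eval (1 - 2 * sin ψ ^ 2) := by
      simp [hQ, Polynomial.eval_comp]
    rw [h3, h1, h2]
    have : ((m:ℤ):ℝ) * (2 * ψ) = 2 * (m * ψ) := by push_cast; ring
    rw [this, cos_two_mul, cos_sq']
    ring
  have hdiv : ∀ u, Q.divX.eval u * u = Q.eval u := by
    intro u
    have h0 : Q.coeff 0 = 0 := by
      rw [Polynomial.coeff_zero_eq_eval_zero]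
      simpa using hQeval 0
    conv_rhs => rw [← Polynomial.divX_mul_X_add Q]
    simp [h0]
  set G := Polynomial.C (1 / (2 * (m:ℝ) ^ 2)) * Q.divX with hG
  have hGeval : ∀ ψ, (m:ℝ) ^ 2 * sin ψ ^ 2 * G.eval (sin ψ ^ 2) = sin (m * ψ) ^ 2 := by
    intro ψ
    have := hdiv (sin ψ ^ 2)
    rw [hQeval] at this
    have h2 : G.eval (sin ψ ^ 2) = 1 / (2 * (m:ℝ) ^ 2) * Q.divX.eval (sin ψ ^ 2) := by
      simp [hG]
    rw [h2]
    field_simp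
    linarith
  have hmain : ∀ u ∈ Ioc (0:ℝ) 1, 0 ≤ G.eval u ∧
      G.eval u ≤ 1 ∧ (m:ℝ) ^ 2 * u * G.eval u ≤ 1 ∧
      ((m:ℝ) ^ 2 * u ≤ 1 → 4 / π ^ 2 ≤ G.eval u) := by
    intro u hu
    set ψ := arcsin √u
    have hs1 : √u ≤ 1 := sqrt_le_one.2 hu.2
    have hs0 : 0 < √u := sqrt_pos.2 hu.1
    have hsin : sin ψ = √u := sin_arcsin (by linarith) hs1
    have hψ0 : 0 ≤ ψ := arcsin_nonneg.2 hs0.le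
    have hψ1 : ψ ≤ π / 2 := arcsin_le_pi_div_two _
    have husq : u = sin ψ ^ 2 := by rw [hsin, sq_sqrt hu.1.le]
    have hval := hGeval ψ
    rw [← husq] at hval
    have hmu : 0 < (m:ℝ) ^ 2 * u := mul_pos (by positivity) hu.1
    have hle : sin (m * ψ) ^ 2 ≤ (m:ℝ) ^ 2 * u := by
      have := abs_sin_natCast_mul_le m ψ
      rw [husq, ← mul_pow, ← sq_abs, ← sq_abs (m * sin ψ), abs_mul, Nat.abs_cast]
      exact pow_le_pow_left₀ (abs_nonneg _) this 2
    refine ⟨?_, ?_, ?_, fun hsmall => ?_⟩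
    · by_contra! hneg
      linarith [mul_neg_of_pos_of_neg hmu hneg, sq_nonneg (sin (m * ψ))]
    · rw [← hval] at hle
      exact le_of_mul_le_mul_left (by linarith) hmu
    · rw [hval]; exact sin_sq_le_one _
    · have hms : m * sin ψ ≤ 1 := by
        rw [husq, ← mul_pow] at hsmall
        exact (abs_le_one_iff_mul_self_le_one.2 (by linarith [sq (m * sin ψ)]) |> abs_le.1).2
      have hψs : 2 / π * ψ ≤ sin ψ := mul_le_sin hψ0 hψ1
      have h1 : m * ψ ≤ π / 2 := by
        have : m * (2 / π * ψ) ≤ 1 := (mul_le_mul_of_nonneg_left hψs hm0.le).trans hms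
        have h2 : m * (2 / π * ψ) = m * ψ * (2 / π) := by ring
        rw [h2, ← le_div_iff₀ (by positivity)] at this
        simpa using this
      have h2 : 2 / π * (m * ψ) ≤ sin (m * ψ) := mul_le_sin (by positivity) h1
      have h3 : 2 / π * (m * sin ψ) ≤ sin (m * ψ) := by
        refine le_trans ?_ h2
        have := sin_le hψ0
        gcongr
      have h4 : (2 / π * (m * sin ψ)) ^ 2 ≤ sin (m * ψ) ^ 2 :=
        pow_le_pow_left₀ (by rw [hsin]; positivity) h3 2
      rw [← hval] at h4
      have h5 : (2 / π * (m * sin ψ)) ^ 2 = (m:ℝ) ^ 2 * u * (4 / π ^ 2) := by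
        rw [husq]; ring
      rw [h5] at h4
      exact le_of_mul_le_mul_left h4 hmu
  refine ⟨G, ?_, fun u hu => ?_⟩
  · refine (Polynomial.natDegree_C_mul_le _ _).trans ?_
    rw [Polynomial.natDegree_divX_eq_natDegree_tsub_one]
    refine Nat.sub_le_sub_right ?_ 1
    refine (Polynomial.natDegree_sub_le _ _).trans (max_le (by simp) ?_)
    refine Polynomial.natDegree_comp_le.trans ?_
    have h1 : (1 - 2 * Polynomial.X : Polynomial ℝ).natDegree ≤ 1 := by compute_degree
    have h2 : (Polynomial.Chebyshev.T ℝ (m:ℤ)).natDegree = m := by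
      rw [Polynomial.Chebyshev.natDegree_T]; simp
    rw [h2]
    nlinarith
  · rcases hu.1.eq_or_lt with h0 | h0
    · subst h0
      have hlim : Filter.Tendsto (fun u => G.eval u) (nhdsWithin 0 (Ioi 0)) (nhds (G.eval 0)) :=
        (G.continuous.tendsto 0).mono_left nhdsWithin_le_nhds
      have hev : ∀ᶠ u in nhdsWithin (0:ℝ) (Ioi 0), u ∈ Ioc (0:ℝ) (1 / (m:ℝ) ^ 2) :=
        Ioc_mem_nhdsGT (by positivity)
      have hm1 : (1:ℝ) / (m:ℝ) ^ 2 ≤ 1 := by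
        rw [div_le_one (by positivity)]
        exact one_le_pow₀ (by exact_mod_cast hm)
      have hlow : 4 / π ^ 2 ≤ G.eval 0 := ge_of_tendsto hlim (hev.mono fun u hu =>
        (hmain u ⟨hu.1, hu.2.trans hm1⟩).2.2.2 (by
          have := hu.2; rw [le_div_iff₀ (by positivity)] at this; linarith))
      exact ⟨le_trans (by positivity) hlow, le_of_tendsto hlim (hev.mono fun u hu =>
        (hmain u ⟨hu.1, hu.2.trans hm1⟩).2.1), by simp, fun _ => hlow⟩
    · exact hmain u ⟨h0, hu.2⟩

lemma exists_integral_concentrated_le {ω : ℝ → ℝ} (hωi : IntervalIntegrable ω volume 0 π)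
    (h0 : ∀ θ ∈ Icc 0 π, 0 ≤ ω θ) {ζ E C : ℝ} (hζ : ζ ∈ Icc 0 π) (hC : 0 < C)
    (hmass : ∀ ρ > 0, ∫ θ in {θ ∈ Icc 0 π | |θ - ζ| ≤ ρ}, ω θ ≤ C * ρ ^ E)
    {r : ℕ} (hr : E + 2 ≤ 2 * r) {a : ℝ} (ha : 0 < a) :
    ∃ C' > 0, ∀ m : ℕ, 1 ≤ m → ∀ F : ℝ → ℝ, Continuous F →
      (∀ θ ∈ Icc 0 π, 0 ≤ F θ ∧ F θ ≤ 1 ∧ ((m:ℝ) ^ 2 * (a * (θ - ζ) ^ 2)) ^ r * F θ ≤ 1) →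
      ∫ θ in (0:ℝ)..π, F θ * ω θ ≤ C' * (m:ℝ) ^ (-E) := by
  have hon : IntegrableOn ω (Icc 0 π) :=
    (intervalIntegrable_iff_integrableOn_Icc_of_le pi_nonneg).1 hωi
  have hsummable : Summable fun k : ℕ => 1 / ((k:ℝ) + 1) ^ 2 := by
    have := (summable_nat_add_iff 1).2 (Real.summable_one_div_nat_pow.2 (one_lt_two (α := ℕ)))
    simpa using this
  set S := ∑' k : ℕ, 1 / ((k:ℝ) + 1) ^ 2
  have hS : 0 < S := hsummable.tsum_pos (fun k => by positivity) 0 (by norm_num)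
  set A := max 1 ((4 / a) ^ r) with hA
  have hA0 : 0 < A := lt_max_of_lt_left one_pos
  refine ⟨A * C * S, by positivity, fun m hm F hF hFb => ?_⟩
  have hm0 : (0:ℝ) < m := by exact_mod_cast hm
  set B : ℕ → Set ℝ := fun k => {θ ∈ Icc 0 π | |θ - ζ| ≤ ((k:ℝ) + 1) / m}
  have hBm : ∀ k, MeasurableSet (B k) := fun k => measurableSet_arc _ _
  have hBs : ∀ k, B k ⊆ Icc 0 π := fun k θ hθ => hθ.1
  set c : ℕ → ℝ := fun k => A / ((k:ℝ) + 1) ^ (2 * r)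
  have hc0 : ∀ k, 0 ≤ c k := fun k => by positivity
  have hpt : ∀ θ ∈ Icc 0 π, F θ * ω θ ≤
      ∑ k ∈ Finset.range (4 * m + 1), c k * (B k).indicator ω θ := by
    intro θ hθ
    obtain ⟨hF0, hF1, hFr⟩ := hFb θ hθ
    set y := |θ - ζ| with hy
    have hy4 : y ≤ 4 := (abs_le.2 ⟨by linarith [hθ.1, hζ.2], by linarith [hθ.2, hζ.1]⟩ :
      |θ - ζ| ≤ π).trans pi_le_four
    set k := ⌊m * y⌋₊
    have hmy : 0 ≤ m * y := by positivity
    have hk1 : (k:ℝ) ≤ m * y := Nat.floor_le hmy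
    have hk2 : m * y < k + 1 := Nat.lt_floor_add_one _
    have hkr : k ∈ Finset.range (4 * m + 1) := by
      rw [Finset.mem_range]
      have : (k:ℝ) < (4 * m + 1 : ℕ) := by push_cast; nlinarith
      exact_mod_cast this
    have hBk : θ ∈ B k := ⟨hθ, by rw [le_div_iff₀ hm0]; linarith⟩
    have hFc : F θ ≤ c k := by
      rw [le_div_iff₀ (by positivity)]
      rcases Nat.eq_zero_or_pos k with hk0 | hkpos
      · simpa [hk0] using (hF1.trans (le_max_left _ _) : F θ ≤ A)
      · have hk1' : (1:ℝ) ≤ k := by exact_mod_cast hkpos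
        have h1 : ((k:ℝ) + 1) ^ 2 ≤ 4 / a * ((m:ℝ) ^ 2 * (a * (θ - ζ) ^ 2)) := by
          have : 4 / a * ((m:ℝ) ^ 2 * (a * (θ - ζ) ^ 2)) = (2 * (m * y)) ^ 2 := by
            rw [hy, mul_pow, mul_pow, sq_abs]; field_simp; ring
          rw [this]
          exact pow_le_pow_left₀ (by positivity) (by linarith) 2
        calc F θ * ((k:ℝ) + 1) ^ (2 * r)
            ≤ F θ * (4 / a * ((m:ℝ) ^ 2 * (a * (θ - ζ) ^ 2))) ^ r := by
              rw [pow_mul]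
              exact mul_le_mul_of_nonneg_left (pow_le_pow_left₀ (by positivity) h1 r) hF0
          _ = (4 / a) ^ r * (((m:ℝ) ^ 2 * (a * (θ - ζ) ^ 2)) ^ r * F θ) := by
              rw [mul_pow]; ring
          _ ≤ (4 / a) ^ r * 1 := mul_le_mul_of_nonneg_left hFr (by positivity)
          _ ≤ A := by rw [mul_one]; exact le_max_right _ _
    calc F θ * ω θ ≤ c k * (B k).indicator ω θ := by
          rw [indicator_of_mem hBk]
          exact mul_le_mul_of_nonneg_right hFc (h0 θ hθ)
      _ ≤ _ := Finset.single_le_sum (f := fun k => c k * (B k).indicator ω θ)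
          (fun i _ => mul_nonneg (hc0 i) (indicator_nonneg (fun x hx => h0 x (hBs i hx)) θ)) hkr
  have hind : ∀ k, IntegrableOn (fun θ => c k * (B k).indicator ω θ) (Icc 0 π) := fun k =>
    (hon.indicator (hBm k)).const_mul _
  have hFω : IntegrableOn (fun θ => F θ * ω θ) (Icc 0 π) :=
    hon.continuousOn_mul hF.continuousOn isCompact_Icc
  rw [intervalIntegral.integral_of_le pi_nonneg, ← integral_Icc_eq_integral_Ioc]
  calc ∫ θ in Icc 0 π, F θ * ω θ
      ≤ ∫ θ in Icc 0 π, ∑ k ∈ Finset.range (4 * m + 1), c k * (B k).indicator ω θ :=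
        setIntegral_mono_on hFω (integrable_finsetSum _ fun k _ => hind k) measurableSet_Icc hpt
    _ = ∑ k ∈ Finset.range (4 * m + 1), c k * ∫ θ in B k, ω θ := by
        rw [integral_finsetSum _ fun k _ => hind k]
        refine Finset.sum_congr rfl fun k _ => ?_
        rw [integral_const_mul, setIntegral_indicator (hBm k), inter_eq_self_of_subset_right (hBs k)]
    _ ≤ ∑ k ∈ Finset.range (4 * m + 1), A * C * (m:ℝ) ^ (-E) * (1 / ((k:ℝ) + 1) ^ 2) := by
        refine Finset.sum_le_sum fun k _ => ?_
        have hk : (1:ℝ) ≤ k + 1 := by linarith [Nat.cast_nonneg (α := ℝ) k]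
        have h1 := hmass (((k:ℝ) + 1) / m) (by positivity)
        have h2 : ((k:ℝ) + 1) ^ E ≤ ((k:ℝ) + 1) ^ (2 * r) / ((k:ℝ) + 1) ^ 2 := by
          rw [le_div_iff₀ (by positivity), ← rpow_natCast, ← rpow_natCast, ← rpow_add (by positivity)]
          exact rpow_le_rpow_of_exponent_le hk (by push_cast; linarith)
        calc c k * ∫ θ in B k, ω θ ≤ c k * (C * (((k:ℝ) + 1) / m) ^ E) :=
              mul_le_mul_of_nonneg_left h1 (hc0 k)
          _ = c k * C * (m:ℝ) ^ (-E) * ((k:ℝ) + 1) ^ E := by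
              rw [div_rpow (by positivity) hm0.le, rpow_neg hm0.le]; ring
          _ ≤ c k * C * (m:ℝ) ^ (-E) * (((k:ℝ) + 1) ^ (2 * r) / ((k:ℝ) + 1) ^ 2) :=
              mul_le_mul_of_nonneg_left h2
                (mul_nonneg (mul_nonneg (hc0 k) hC.le) (by positivity))
          _ = _ := by simp only [c]; field_simp
    _ = A * C * (m:ℝ) ^ (-E) * ∑ k ∈ Finset.range (4 * m + 1), 1 / ((k:ℝ) + 1) ^ 2 := by
        rw [Finset.mul_sum]
    _ ≤ A * C * (m:ℝ) ^ (-E) * S := by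
        refine mul_le_mul_of_nonneg_left ?_ (by positivity)
        exact hsummable.sum_le_tsum _ fun k _ => by positivity
    _ = _ := by ring

/-- If a density has a singularity at `ζ` where the mass of the arc of radius `ρ` is comparable
with `ρ ^ E`, then a quadrature with equal weights of degree `n` has at least a constant times
`n ^ E` nodes. The polynomial `q` encodes the squared distance to `ζ`. -/
lemma exists_card_nodes_lower {ω : ℝ → ℝ} (hωi : IntervalIntegrable ω volume 0 π)
    (h0 : ∀ θ ∈ Icc 0 π, 0 ≤ ω θ) {W : ℝ} (hW : ∫ θ in (0:ℝ)..π, ω θ = W) (hWpos : 0 < W)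
    {ζ E C c : ℝ} (hζ : ζ ∈ Icc 0 π) (hE : 0 < E) (hC : 0 < C)
    (hupper : ∀ ρ > 0, ∫ θ in {θ ∈ Icc 0 π | |θ - ζ| ≤ ρ}, ω θ ≤ C * ρ ^ E) (hc : 0 < c)
    (hlower : ∀ ρ, 0 < ρ → ρ ≤ 1 →
      c * ρ ^ E ≤ ∫ θ in {θ ∈ Icc 0 π | |θ - ζ| ≤ ρ}, ω θ)
    (q : Polynomial ℝ) (hq : q.natDegree ≤ 2) {a b : ℝ} (ha : 0 < a)
    (hqa : ∀ θ ∈ Icc 0 π, a * (θ - ζ) ^ 2 ≤ q.eval (cos θ))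
    (hqb : ∀ θ ∈ Icc 0 π, q.eval (cos θ) ≤ b * (θ - ζ) ^ 2)
    (hq1 : ∀ θ ∈ Icc 0 π, q.eval (cos θ) ≤ 1) :
    ∃ c' > 0, ∀ n N : ℕ, 1 ≤ n → ∀ t : Fin N → ℝ, (∀ i, t i ∈ Icc (-1:ℝ) 1) →
      (∀ p : Polynomial ℝ, p.natDegree ≤ n →
        ∫ θ in (0:ℝ)..π, p.eval (cos θ) * ω θ = W / N * ∑ i, p.eval (t i)) →
      c' * (n:ℝ) ^ E ≤ N := by
  have hon : IntegrableOn ω (Icc 0 π) :=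
    (intervalIntegrable_iff_integrableOn_Icc_of_le pi_nonneg).1 hωi
  have hq0 : ∀ θ ∈ Icc 0 π, 0 ≤ q.eval (cos θ) := fun θ hθ =>
    le_trans (by positivity) (hqa θ hθ)
  have hqt : ∀ t ∈ Icc (-1:ℝ) 1, q.eval t ∈ Icc (0:ℝ) 1 := fun t ht => by
    have hmem : arccos t ∈ Icc 0 π := ⟨arccos_nonneg t, arccos_le_pi t⟩
    rw [← cos_arccos ht.1 ht.2]
    exact ⟨hq0 _ hmem, hq1 _ hmem⟩
  choose G hGdeg hG using fun m : ℕ => exists_fejer_polynomial (m := m + 1) (by omega)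
  obtain ⟨r, hr⟩ : ∃ r : ℕ, E / 2 + 1 ≤ r := exists_nat_ge _
  obtain ⟨C₁, hC₁, hconc⟩ := exists_integral_concentrated_le hωi h0 hζ hC hupper
    (r := r) (by linarith) ha
  have hint : ∀ p : Polynomial ℝ, IntervalIntegrable (fun θ => p.eval (cos θ) * ω θ) volume 0 π :=
    fun p => hωi.continuousOn_mul (by fun_prop)
  -- lower bound for the integral of the kernel
  set β := 1 / (|b| + 1) with hβ
  have hβ0 : 0 < β := by positivity
  have hβ1 : β ≤ 1 := by rw [hβ, div_le_one (by positivity)]; linarith [abs_nonneg b]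
  have hβb : |b| * β ^ 2 ≤ 1 := by
    have : |b| * β ≤ 1 := by
      rw [hβ, mul_one_div, div_le_one (by positivity)]; linarith
    nlinarith
  set c₂ := (4 / π ^ 2) ^ (r + 1) * (c * β ^ E) with hc₂
  have hc₂0 : 0 < c₂ := by positivity
  have hGlow : ∀ m : ℕ, c₂ * ((m + 1 : ℕ):ℝ) ^ (-E) ≤
      ∫ θ in (0:ℝ)..π, (((G m).comp q) ^ (r + 1)).eval (cos θ) * ω θ := by
    intro m
    set M : ℝ := ((m + 1 : ℕ):ℝ) with hM
    have hM1 : 1 ≤ M := by rw [hM]; exact_mod_cast Nat.succ_pos m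
    have hM0 : 0 < M := by linarith
    set S := {θ ∈ Icc 0 π | |θ - ζ| ≤ β / M}
    have hSm : MeasurableSet S := measurableSet_arc _ _
    have hSs : S ⊆ Icc 0 π := fun θ hθ => hθ.1
    have hint' := (intervalIntegrable_iff_integrableOn_Icc_of_le pi_nonneg).1
      (hint (((G m).comp q) ^ (r + 1)))
    rw [intervalIntegral.integral_of_le pi_nonneg, ← integral_Icc_eq_integral_Ioc]
    calc c₂ * M ^ (-E) = (4 / π ^ 2) ^ (r + 1) * (c * (β / M) ^ E) := by
          rw [div_rpow hβ0.le hM0.le, rpow_neg hM0.le, hc₂]; ring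
      _ ≤ (4 / π ^ 2) ^ (r + 1) * ∫ θ in S, ω θ :=
          mul_le_mul_of_nonneg_left (hlower _ (by positivity)
            ((div_le_self hβ0.le hM1).trans hβ1)) (by positivity)
      _ = ∫ θ in S, (4 / π ^ 2) ^ (r + 1) * ω θ := (integral_const_mul _ _).symm
      _ ≤ ∫ θ in S, (((G m).comp q) ^ (r + 1)).eval (cos θ) * ω θ := by
          refine setIntegral_mono_on ((hon.mono_set hSs).const_mul _) (hint'.mono_set hSs) hSm ?_
          intro θ hθ
          refine mul_le_mul_of_nonneg_right ?_ (h0 θ hθ.1)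
          rw [Polynomial.eval_pow, Polynomial.eval_comp]
          refine pow_le_pow_left₀ (by positivity) ?_ _
          refine (hG m _ ⟨hq0 θ hθ.1, hq1 θ hθ.1⟩).2.2.2 ?_
          calc M ^ 2 * q.eval (cos θ) ≤ M ^ 2 * (|b| * (β / M) ^ 2) := by
                refine mul_le_mul_of_nonneg_left ((hqb θ hθ.1).trans ?_) (by positivity)
                refine mul_le_mul (le_abs_self b) ?_ (by positivity) (abs_nonneg b)
                rw [← sq_abs]
                exact pow_le_pow_left₀ (abs_nonneg _) hθ.2 2
            _ = |b| * β ^ 2 := by field_simp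
            _ ≤ 1 := hβb
      _ ≤ _ := by
          refine setIntegral_mono_set hint' ?_ hSs.eventuallyLE
          refine (ae_restrict_iff' measurableSet_Icc).2 (Filter.Eventually.of_forall fun θ hθ => ?_)
          refine mul_nonneg ?_ (h0 θ hθ)
          rw [Polynomial.eval_pow, Polynomial.eval_comp]
          exact pow_nonneg (hG m _ ⟨hq0 θ hθ, hq1 θ hθ⟩).1 _
  -- upper bounds for integrals of kernels
  have hG1 : ∀ m : ℕ, ∫ θ in (0:ℝ)..π, (((G m).comp q) ^ r).eval (cos θ) * ω θ ≤
      C₁ * ((m + 1 : ℕ):ℝ) ^ (-E) := by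
    intro m
    refine hconc (m + 1) (by omega) (fun θ => (((G m).comp q) ^ r).eval (cos θ)) (by fun_prop)
      fun θ hθ => ?_
    obtain ⟨g0, g1, g2, -⟩ := hG m _ ⟨hq0 θ hθ, hq1 θ hθ⟩
    simp only [Polynomial.eval_pow, Polynomial.eval_comp]
    refine ⟨pow_nonneg g0 _, pow_le_one₀ g0 g1, ?_⟩
    rw [← mul_pow]
    refine pow_le_one₀ (by positivity) (le_trans ?_ g2)
    have := hqa θ hθ
    gcongr
  have hG2 : ∀ m : ℕ, ∫ θ in (0:ℝ)..π,
      ((m + 1 : ℕ):ℝ) ^ 2 * q.eval (cos θ) * (((G m).comp q) ^ (r + 1)).eval (cos θ) * ω θ ≤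
      C₁ * ((m + 1 : ℕ):ℝ) ^ (-E) := by
    intro m
    refine hconc (m + 1) (by omega) (fun θ => ((m + 1 : ℕ):ℝ) ^ 2 * q.eval (cos θ) *
      (((G m).comp q) ^ (r + 1)).eval (cos θ)) (by fun_prop) fun θ hθ => ?_
    obtain ⟨g0, g1, g2, -⟩ := hG m _ ⟨hq0 θ hθ, hq1 θ hθ⟩
    simp only [Polynomial.eval_pow, Polynomial.eval_comp]
    set g := (G m).eval (q.eval (cos θ))
    set v := ((m + 1 : ℕ):ℝ) ^ 2 * q.eval (cos θ) with hv
    have hv0 : 0 ≤ v := mul_nonneg (by positivity) (hq0 θ hθ)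
    have hre : v * g ^ (r + 1) = v * g * g ^ r := by rw [pow_succ]; ring
    rw [hre]
    refine ⟨by positivity, mul_le_one₀ g2 (by positivity) (pow_le_one₀ g0 g1), ?_⟩
    have : (((m + 1 : ℕ):ℝ) ^ 2 * (a * (θ - ζ) ^ 2)) ^ r * (v * g * g ^ r) =
        v * g * (((m + 1 : ℕ):ℝ) ^ 2 * (a * (θ - ζ) ^ 2) * g) ^ r := by
      rw [mul_pow _ g]; ring
    rw [this]
    refine mul_le_one₀ g2 (by positivity) (pow_le_one₀ (by positivity) (le_trans ?_ g2))
    have := hqa θ hθ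
    rw [hv]
    gcongr
  obtain ⟨A, hA⟩ := exists_nat_gt (max 1 (C₁ / c₂))
  have hA1 : (1:ℝ) < A := (le_max_left _ _).trans_lt hA
  have hAC : C₁ < c₂ * (A:ℝ) ^ 2 := by
    have h1 : C₁ / c₂ < A := (le_max_right _ _).trans_lt hA
    rw [div_lt_iff₀ hc₂0] at h1
    nlinarith
  have hA1' : 1 ≤ A := by exact_mod_cast hA1.le
  set D := 2 * A * (r + 1) with hD
  have hD0 : 0 < D := by positivity
  set c₃ := W * (4 / π ^ 2) ^ r / C₁ with hc₃
  have hc₃0 : 0 < c₃ := by positivity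
  refine ⟨min (c₃ / (2 * D : ℝ) ^ E) (1 / (D:ℝ) ^ E), by positivity, fun n N hn t ht hquad => ?_⟩
  have hNpos : 0 < N := by
    rcases Nat.eq_zero_or_pos N with rfl | h
    · have := hquad 1 (by simp)
      simp at this
      linarith
    · exact h
  have hN1 : (1:ℝ) ≤ N := by exact_mod_cast hNpos
  rcases lt_or_ge n D with hnD | hnD
  · calc min (c₃ / (2 * D : ℝ) ^ E) (1 / (D:ℝ) ^ E) * (n:ℝ) ^ E
        ≤ 1 / (D:ℝ) ^ E * (D:ℝ) ^ E := by
          have : (n:ℝ) ≤ D := by exact_mod_cast hnD.le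
          gcongr
          exact min_le_right _ _
      _ = 1 := by rw [one_div, inv_mul_cancel₀]; positivity
      _ ≤ N := hN1
  · set k := n / D with hk
    have hk1 : 1 ≤ k := (Nat.one_le_div_iff hD0).2 hnD
    have hkn : D * k ≤ n := Nat.mul_div_le n D
    have hkn' : (n:ℝ) ≤ 2 * D * k := by
      have h1 : n < D * (k + 1) := Nat.lt_mul_div_succ n hD0
      have h2 : n ≤ 2 * D * k := by nlinarith
      exact_mod_cast h2
    obtain ⟨k', hk'⟩ : ∃ k', k = k' + 1 := ⟨k - 1, by omega⟩
    have hAk : 1 ≤ A * k := Nat.mul_pos hA1' hk1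
    obtain ⟨m, hm⟩ : ∃ m, A * k = m + 1 := ⟨A * k - 1, by omega⟩
    have hk0 : (0:ℝ) < k := by exact_mod_cast hk1
    have hm0 : (0:ℝ) < ((m + 1 : ℕ):ℝ) := by positivity
    have hmA : ((m + 1 : ℕ):ℝ) = A * k := by rw [← hm]; push_cast; ring
    have hdegG : ∀ m s, (((G m).comp q) ^ s).natDegree ≤ s * (m * 2) := fun m s => by
      refine Polynomial.natDegree_pow_le_of_le s ?_
      refine Polynomial.natDegree_comp_le.trans (Nat.mul_le_mul ?_ hq)
      simpa using hGdeg m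
    -- there is a node near the singularity
    obtain ⟨i, hi⟩ : ∃ i, (k:ℝ) ^ 2 * q.eval (t i) ≤ 1 := by
      set p : Polynomial ℝ := (1 - Polynomial.C ((k:ℝ) ^ 2) * q) * ((G m).comp q) ^ (r + 1) with hp
      have hpdeg : p.natDegree ≤ n := by
        have h1 : (1 - Polynomial.C ((k:ℝ) ^ 2) * q).natDegree ≤ 2 :=
          (Polynomial.natDegree_sub_le _ _).trans (max_le (by simp)
            ((Polynomial.natDegree_C_mul_le _ _).trans hq))
        refine Polynomial.natDegree_mul_le.trans ((add_le_add h1 (hdegG m (r + 1))).trans ?_)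
        have h2 : D * k = 2 * (r + 1) * (m + 1) := by rw [← hm, hD]; ring
        nlinarith
      have hpe : ∀ x, p.eval x = (((G m).comp q) ^ (r + 1)).eval x -
          (k:ℝ) ^ 2 * q.eval x * (((G m).comp q) ^ (r + 1)).eval x := fun x => by
        simp only [hp, Polynomial.eval_mul, Polynomial.eval_sub, Polynomial.eval_one,
          Polynomial.eval_C]
        ring
      have hpint : 0 < ∫ θ in (0:ℝ)..π, p.eval (cos θ) * ω θ := by
        have h1 : ∫ θ in (0:ℝ)..π, p.eval (cos θ) * ω θ =
            (∫ θ in (0:ℝ)..π, (((G m).comp q) ^ (r + 1)).eval (cos θ) * ω θ) -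
            1 / (A:ℝ) ^ 2 * ∫ θ in (0:ℝ)..π, ((m + 1 : ℕ):ℝ) ^ 2 * q.eval (cos θ) *
              (((G m).comp q) ^ (r + 1)).eval (cos θ) * ω θ := by
          rw [← intervalIntegral.integral_const_mul, ← intervalIntegral.integral_sub (hint _)]
          · refine intervalIntegral.integral_congr fun θ _ => ?_
            simp only [hpe, hmA]
            field_simp
          · exact (hωi.continuousOn_mul (by fun_prop)).const_mul _
        rw [h1]
        have h2 := hGlow m
        have h3 := hG2 m
        have h4 : 0 < ((m + 1 : ℕ):ℝ) ^ (-E) := by positivity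
        have h5 : 1 / (A:ℝ) ^ 2 * C₁ < c₂ := by
          rw [one_div_mul_eq_div, div_lt_iff₀ (by positivity)]; exact hAC
        have h6 := mul_le_mul_of_nonneg_left h3 (show 0 ≤ 1 / (A:ℝ) ^ 2 by positivity)
        have h7 := mul_lt_mul_of_pos_right h5 h4
        linarith
      by_contra! hcon
      rw [hquad p hpdeg] at hpint
      have : W / N * ∑ i, p.eval (t i) ≤ 0 := by
        refine mul_nonpos_of_nonneg_of_nonpos (by positivity) (Finset.sum_nonpos fun i _ => ?_)
        have hg := pow_nonneg (hG m _ (hqt _ (ht i))).1 (r + 1)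
        simp only [hpe, Polynomial.eval_pow, Polynomial.eval_comp]
        nlinarith [hcon i]
      linarith
    have hquad' := hquad (((G k').comp q) ^ r) (by
      refine (hdegG k' r).trans (le_trans ?_ hkn)
      rw [hD, hk']
      calc r * (k' * 2) ≤ (r + 1) * ((k' + 1) * 2) := by gcongr <;> omega
        _ ≤ A * ((r + 1) * ((k' + 1) * 2)) := Nat.le_mul_of_pos_left _ hA1'
        _ = _ := by ring)
    have hup := hG1 k'
    rw [hquad', ← hk'] at hup
    have hlow : (4 / π ^ 2) ^ r ≤ ∑ i, (((G k').comp q) ^ r).eval (t i) := by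
      refine le_trans ?_ (Finset.single_le_sum
        (f := fun i => (((G k').comp q) ^ r).eval (t i)) (fun j _ => ?_) (Finset.mem_univ i))
      · simp only [Polynomial.eval_pow, Polynomial.eval_comp]
        refine pow_le_pow_left₀ (by positivity) ?_ _
        exact (hG k' _ (hqt _ (ht i))).2.2.2 (by rw [← hk']; exact hi)
      · simp only [Polynomial.eval_pow, Polynomial.eval_comp]
        exact pow_nonneg (hG k' _ (hqt _ (ht j))).1 _
    have hfin : W * (4 / π ^ 2) ^ r * (k:ℝ) ^ E ≤ C₁ * N := by
      have h1 := (mul_le_mul_of_nonneg_left hlow (show 0 ≤ W / N by positivity)).trans hup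
      rw [rpow_neg hk0.le, ← div_eq_mul_inv, le_div_iff₀ (by positivity), div_mul_eq_mul_div,
        div_mul_eq_mul_div, div_le_iff₀ (by positivity)] at h1
      exact h1
    calc min (c₃ / (2 * D : ℝ) ^ E) (1 / (D:ℝ) ^ E) * (n:ℝ) ^ E
        ≤ c₃ / (2 * D : ℝ) ^ E * (2 * D * k : ℝ) ^ E := by
          gcongr
          exact min_le_left _ _
      _ = c₃ * (k:ℝ) ^ E := by
          rw [mul_rpow (by positivity) hk0.le]
          field_simp
      _ ≤ N := by
          rw [hc₃, div_mul_eq_mul_div, div_le_iff₀ hC₁]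
          linarith

/-! ### The substitution `x = cos θ` -/

/-- Two nonnegative functions are comparable on `S` up to positive constants. -/
def ComparableOn (S : Set ℝ) (f g : ℝ → ℝ) : Prop :=
  ∃ a > 0, ∃ b > 0, ∀ x ∈ S, 0 ≤ g x ∧ a * g x ≤ f x ∧ f x ≤ b * g x

lemma ComparableOn.mul {S : Set ℝ} {f g f' g' : ℝ → ℝ} (h : ComparableOn S f g)
    (h' : ComparableOn S f' g') :
    ComparableOn S (fun x => f x * f' x) (fun x => g x * g' x) := by
  obtain ⟨a, ha, b, hb, h⟩ := h
  obtain ⟨a', ha', b', hb', h'⟩ := h'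
  refine ⟨a * a', by positivity, b * b', by positivity, fun x hx => ?_⟩
  obtain ⟨h0, h1, h2⟩ := h x hx
  obtain ⟨h0', h1', h2'⟩ := h' x hx
  refine ⟨mul_nonneg h0 h0', ?_, ?_⟩
  · rw [mul_mul_mul_comm]
    exact mul_le_mul h1 h1' (by positivity) (le_trans (by positivity) h1)
  · rw [mul_mul_mul_comm b]
    exact mul_le_mul h2 h2' (le_trans (by positivity) h1') (by positivity)

lemma ComparableOn.prod {S : Set ℝ} {σ : Type*} (T : Finset σ) {f g : σ → ℝ → ℝ}
    (h : ∀ i, ComparableOn S (f i) (g i)) :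
    ComparableOn S (fun x => ∏ i ∈ T, f i x) (fun x => ∏ i ∈ T, g i x) := by
  classical
  induction T using Finset.induction_on with
  | empty => exact ⟨1, one_pos, 1, one_pos, by simp⟩
  | insert i T hi ih =>
    simp only [Finset.prod_insert hi]
    exact (h i).mul ih

lemma ComparableOn.rpow {S : Set ℝ} {f g : ℝ → ℝ} (h : ComparableOn S f g) (r : ℝ) :
    ComparableOn S (fun x => f x ^ r) (fun x => g x ^ r) := by
  obtain ⟨a, ha, b, hb, h⟩ := h
  refine ⟨min (a ^ r) (b ^ r), by positivity, max (a ^ r) (b ^ r), by positivity, fun x hx => ?_⟩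
  obtain ⟨h0, h1, h2⟩ := h x hx
  refine ⟨by positivity, ?_⟩
  rcases h0.eq_or_lt with hg | hg
  · have hf : f x = 0 := le_antisymm (by simpa [← hg] using h2) (by simpa [← hg] using h1)
    simp only [← hg, hf]
    rcases eq_or_ne r 0 with rfl | hr
    · simp
    · simp [zero_rpow hr]
  · have hf : 0 < f x := lt_of_lt_of_le (by positivity) h1
    have key : min (a ^ r) (b ^ r) ≤ (f x / g x) ^ r ∧ (f x / g x) ^ r ≤ max (a ^ r) (b ^ r) := by
      have h3 : a ≤ f x / g x := (le_div_iff₀ hg).2 h1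
      have h4 : f x / g x ≤ b := (div_le_iff₀ hg).2 h2
      have h5 : 0 < f x / g x := by positivity
      rcases le_total 0 r with hr | hr
      · exact ⟨(min_le_left _ _).trans (rpow_le_rpow ha.le h3 hr),
          (rpow_le_rpow h5.le h4 hr).trans (le_max_right _ _)⟩
      · exact ⟨(min_le_right _ _).trans (rpow_le_rpow_of_nonpos h5 h4 hr),
          (rpow_le_rpow_of_nonpos ha h3 hr).trans (le_max_left _ _)⟩
    rw [div_rpow hf.le hg.le] at key
    have hgr : 0 < g x ^ r := by positivity
    exact ⟨(le_div_iff₀ hgr).1 key.1, (div_le_iff₀ hgr).1 key.2⟩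

lemma one_sub_cos_bounds {θ : ℝ} (hθ : θ ∈ Icc 0 π) :
    2 / π ^ 2 * θ ^ 2 ≤ 1 - cos θ ∧ 1 - cos θ ≤ 1 / 2 * θ ^ 2 := by
  have h1 := cos_le_one_sub_mul_cos_sq (x := θ) (abs_le.2 ⟨by linarith [hθ.1, pi_pos], hθ.2⟩)
  have h2 := one_sub_sq_div_two_le_cos (x := θ)
  constructor <;> linarith

lemma one_add_cos_bounds {θ : ℝ} (hθ : θ ∈ Icc 0 π) :
    2 / π ^ 2 * (θ - π) ^ 2 ≤ 1 + cos θ ∧ 1 + cos θ ≤ 1 / 2 * (θ - π) ^ 2 := by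
  have := one_sub_cos_bounds (θ := π - θ) ⟨by linarith [hθ.2], by linarith [hθ.1]⟩
  rw [cos_pi_sub, sub_neg_eq_add, ← neg_sub, neg_sq] at this
  simpa using this

lemma exists_mul_abs_sub_le_abs_cos_sub_cos {ζ : ℝ} (hζ : ζ ∈ Ioo 0 π) :
    ∃ a > 0, ∀ θ ∈ Icc 0 π, a * |θ - ζ| ≤ |cos θ - cos ζ| := by
  set δ := min ζ (π - ζ) with hδ
  have hδ0 : 0 < δ := lt_min hζ.1 (by linarith [hζ.2])
  have hδ1 := min_le_left ζ (π - ζ)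
  have hδ2 := min_le_right ζ (π - ζ)
  refine ⟨2 * (δ / π) * (1 / π), by positivity, fun θ hθ => ?_⟩
  rw [cos_sub_cos, abs_mul, abs_mul, abs_neg, abs_two]
  have hp : (0:ℝ) < 2 / π := by positivity
  have h1 : δ / π ≤ |sin ((θ + ζ) / 2)| := by
    have he : δ / π = 2 / π * (δ / 2) := by ring
    refine le_trans ?_ (le_abs_self _)
    rw [he]
    rcases le_total ((θ + ζ) / 2) (π / 2) with hx | hx
    · refine le_trans ?_ (mul_le_sin (by linarith [hθ.1, hζ.1]) hx)
      exact mul_le_mul_of_nonneg_left (by linarith [hθ.1]) hp.le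
    · rw [← sin_pi_sub]
      refine le_trans ?_ (mul_le_sin (by linarith [hθ.2, hζ.2]) (by linarith))
      exact mul_le_mul_of_nonneg_left (by linarith [hθ.2]) hp.le
  have h2 : 1 / π * |θ - ζ| ≤ |sin ((θ - ζ) / 2)| := by
    refine le_trans (le_of_eq ?_) (mul_abs_le_abs_sin ?_)
    · rw [abs_div, abs_two]; ring
    · rw [abs_div, abs_two]
      have : |θ - ζ| ≤ π := abs_le.2 ⟨by linarith [hθ.1, hζ.2], by linarith [hθ.2, hζ.1]⟩
      linarith
  calc 2 * (δ / π) * (1 / π) * |θ - ζ| = 2 * (δ / π) * (1 / π * |θ - ζ|) := by ring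
    _ ≤ 2 * |sin ((θ + ζ) / 2)| * |sin ((θ - ζ) / 2)| := by gcongr

/-- The density on `[0, π]` obtained from a generalized Jacobi weight by `x = cos θ`. -/
def jacobiDensity {σ : Type*} [Fintype σ] (s : σ → ℝ) (α β : ℝ) (γ : σ → ℝ) (h : ℝ → ℝ) (θ : ℝ) :
    ℝ :=
  h (cos θ) * ((1 - cos θ) ^ (α + 1 / 2) * ((1 + cos θ) ^ (β + 1 / 2) *
    ∏ i, |cos θ - s i| ^ γ i))

lemma integral_eq_integral_jacobiDensity {σ : Type*} [Fintype σ] {s : σ → ℝ} {α β : ℝ} {γ : σ → ℝ}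
    {h w : ℝ → ℝ} (hw : ∀ x ∈ Icc (-1:ℝ) 1,
      w x = h x * (1 - x) ^ α * (1 + x) ^ β * ∏ i, |x - s i| ^ (γ i)) (g : ℝ → ℝ) :
    ∫ x in (-1:ℝ)..1, g x * w x =
      ∫ θ in (0:ℝ)..π, g (cos θ) * jacobiDensity s α β γ h θ := by
  rw [intervalIntegral.integral_of_le (by norm_num), ← integral_Icc_eq_integral_Ioc,
    ← bijOn_cos.image_eq, integral_image_eq_integral_abs_deriv_smul measurableSet_Icc
      (fun x _ => (hasDerivAt_cos x).hasDerivWithinAt) injOn_cos,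
    intervalIntegral.integral_of_le pi_nonneg, integral_Icc_eq_integral_Ioo,
    integral_Ioc_eq_integral_Ioo]
  refine setIntegral_congr_fun measurableSet_Ioo fun θ hθ => ?_
  have hsin : 0 < sin θ := sin_pos_of_pos_of_lt_pi hθ.1 hθ.2
  have hc1 : cos θ < 1 := by
    nlinarith [sin_sq_add_cos_sq θ, cos_le_one θ, pow_pos hsin 2]
  have hc2 : -1 < cos θ := by
    nlinarith [sin_sq_add_cos_sq θ, neg_one_le_cos θ, pow_pos hsin 2]
  have hsq : sin θ = (1 - cos θ) ^ (1 / 2 : ℝ) * (1 + cos θ) ^ (1 / 2 : ℝ) := by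
    rw [← mul_rpow (by linarith) (by linarith), ← sqrt_eq_rpow, eq_comm, sqrt_eq_iff_mul_self_eq_of_pos hsin]
    linarith [sin_sq_add_cos_sq θ, sq (sin θ), sq (cos θ)]
  simp only [smul_eq_mul, abs_neg, abs_of_pos hsin]
  rw [hw _ ⟨hc2.le, hc1.le⟩, jacobiDensity, rpow_add (by linarith), rpow_add (by linarith), hsq]
  ring

lemma measurable_jacobiDensity {σ : Type*} [Fintype σ] (s : σ → ℝ) (α β : ℝ) (γ : σ → ℝ)
    {h : ℝ → ℝ} (hh : Measurable h) : Measurable (jacobiDensity s α β γ h) := by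
  unfold jacobiDensity
  have := measurable_cos
  refine (hh.comp this).mul (((measurable_const.sub this).pow_const _).mul
    (((measurable_const.add this).pow_const _).mul ?_))
  exact Finset.measurable_fun_prod _ fun i _ => ((this.sub_const _).abs).pow_const _

/-- The arguments of the singularities of a generalized Jacobi weight. -/
def jacobiArg {σ : Type*} (s : σ → ℝ) : Option (Option σ) → ℝ
  | none => 0
  | some none => π
  | some (some i) => arccos (s i)

/-- The exponents at the singularities of the density `jacobiDensity`. -/
def jacobiExp {σ : Type*} (α β : ℝ) (γ : σ → ℝ) : Option (Option σ) → ℝ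
  | none => 2 * α + 1
  | some none => 2 * β + 1
  | some (some i) => γ i

lemma arccos_mem_Ioo {x : ℝ} (hx : x ∈ Ioo (-1:ℝ) 1) : arccos x ∈ Ioo 0 π :=
  ⟨arccos_pos.2 hx.2, (arccos_le_pi x).lt_of_ne fun h => by
    have := arccos_eq_pi.1 h
    linarith [hx.1]⟩

lemma jacobiArg_injective {σ : Type*} {s : σ → ℝ} (hs : Function.Injective s)
    (hsI : ∀ i, s i ∈ Ioo (-1:ℝ) 1) : Function.Injective (jacobiArg s) := by
  have hA := fun i => arccos_mem_Ioo (hsI i)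
  have hpi := pi_pos
  rintro (_ | _ | i) (_ | _ | j) hij <;> simp only [jacobiArg] at hij
  · rfl
  · linarith
  · linarith [(hA j).1]
  · linarith
  · rfl
  · linarith [(hA j).2]
  · linarith [(hA i).1]
  · linarith [(hA i).2]
  · rw [hs (arccos_injOn (Ioo_subset_Icc_self (hsI i)) (Ioo_subset_Icc_self (hsI j)) hij)]

lemma jacobiArg_mem {σ : Type*} (s : σ → ℝ) (j : Option (Option σ)) :
    jacobiArg s j ∈ Icc 0 π := by
  rcases j with _ | _ | i
  · exact ⟨le_rfl, pi_nonneg⟩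
  · exact ⟨pi_nonneg, le_rfl⟩
  · exact ⟨arccos_nonneg _, arccos_le_pi _⟩

lemma comparableOn_jacobiDensity {σ : Type*} [Fintype σ] {s : σ → ℝ}
    (hsI : ∀ i, s i ∈ Ioo (-1:ℝ) 1) (α β : ℝ) (γ : σ → ℝ) {h : ℝ → ℝ} {m M : ℝ} (hm : 0 < m)
    (hbound : ∀ x ∈ Icc (-1:ℝ) 1, m ≤ h x ∧ h x ≤ M) :
    ComparableOn (Icc 0 π) (jacobiDensity s α β γ h)
      (fun θ => ∏ j, |θ - jacobiArg s j| ^ jacobiExp α β γ j) := by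
  have hM : 0 < M := by
    obtain ⟨h1, h2⟩ := hbound 0 (by norm_num)
    linarith
  have hh : ComparableOn (Icc 0 π) (fun θ => h (cos θ)) (fun _ => 1) :=
    ⟨m, hm, M, hM, fun θ _ => by
      simpa using hbound (cos θ) ⟨neg_one_le_cos θ, cos_le_one θ⟩⟩
  have h1 : ComparableOn (Icc 0 π) (fun θ => 1 - cos θ) (fun θ => |θ - 0| ^ (2:ℝ)) :=
    ⟨2 / π ^ 2, by positivity, 1 / 2, by positivity, fun θ hθ => by
      have := one_sub_cos_bounds hθ
      simp only [rpow_two, sq_abs, sub_zero]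
      exact ⟨by positivity, this⟩⟩
  have h2 : ComparableOn (Icc 0 π) (fun θ => 1 + cos θ) (fun θ => |θ - π| ^ (2:ℝ)) :=
    ⟨2 / π ^ 2, by positivity, 1 / 2, by positivity, fun θ hθ => by
      have := one_add_cos_bounds hθ
      simp only [rpow_two, sq_abs]
      exact ⟨by positivity, this⟩⟩
  have h3 : ∀ i, ComparableOn (Icc 0 π) (fun θ => |cos θ - s i|) (fun θ => |θ - arccos (s i)|) :=
    fun i => by
      obtain ⟨a, ha, hb⟩ := exists_mul_abs_sub_le_abs_cos_sub_cos (arccos_mem_Ioo (hsI i))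
      have hc : cos (arccos (s i)) = s i := cos_arccos (hsI i).1.le (hsI i).2.le
      rw [hc] at hb
      refine ⟨a, ha, 1, one_pos, fun θ hθ => ⟨abs_nonneg _, hb θ hθ, ?_⟩⟩
      have := abs_cos_sub_cos_le θ (arccos (s i))
      rwa [hc, ← one_mul |θ - _|] at this
  have := hh.mul ((h1.rpow (α + 1 / 2)).mul ((h2.rpow (β + 1 / 2)).mul
    (ComparableOn.prod Finset.univ fun i => (h3 i).rpow (γ i))))
  convert this using 2 with θ
  · rfl
  rw [Fintype.prod_option, Fintype.prod_option, one_mul, ← rpow_mul (abs_nonneg _),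
    ← rpow_mul (abs_nonneg _)]
  simp only [jacobiArg, jacobiExp]
  ring_nf

/-! ### Assembling the two bounds -/

section Jacobi

variable {σ : Type*} [Fintype σ] {s : σ → ℝ} {α β : ℝ} {γ : σ → ℝ} {h w : ℝ → ℝ} {m M : ℝ}

lemma exists_jacobi_chebQuad (hs : Function.Injective s) (hsI : ∀ i, s i ∈ Ioo (-1:ℝ) 1)
    (hα : -1 < α) (hβ : -1 < β) (hγ : ∀ i, -1 < γ i) (hmeas : Measurable h)
    (hm : 0 < m) (hbound : ∀ x ∈ Icc (-1:ℝ) 1, m ≤ h x ∧ h x ≤ M)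
    (hw : ∀ x ∈ Icc (-1:ℝ) 1,
      w x = h x * (1 - x) ^ α * (1 + x) ^ β * ∏ i, |x - s i| ^ (γ i))
    {κ : ℝ} (hκ1 : 1 ≤ κ) (hκα : 2 * (α + 1) ≤ κ) (hκβ : 2 * (β + 1) ≤ κ)
    (hκγ : ∀ i, γ i + 1 ≤ κ) :
    ∃ C > (0:ℝ), ∀ n : ℕ, 1 ≤ n → ∀ N : ℕ, C * (n:ℝ) ^ κ ≤ N →
      ∃ t : Fin N → ℝ, IsChebQuad w n N t := by
  have hinj := jacobiArg_injective hs hsI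
  have hmem := jacobiArg_mem s
  have he : ∀ j, -1 < jacobiExp α β γ j := by
    rintro (_ | _ | i)
    · simp only [jacobiExp]; linarith
    · simp only [jacobiExp]; linarith
    · exact hγ i
  have heκ : ∀ j, jacobiExp α β γ j + 1 ≤ κ := by
    rintro (_ | _ | i)
    · simp only [jacobiExp]; linarith
    · simp only [jacobiExp]; linarith
    · exact hκγ i
  obtain ⟨a, ha, b, hb, hab⟩ := comparableOn_jacobiDensity hsI α β γ hm hbound
  set ω := jacobiDensity s α β γ h
  have hω0 : ∀ θ ∈ Icc 0 π, 0 ≤ ω θ := fun θ hθ =>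
    (mul_nonneg ha.le (hab θ hθ).1).trans (hab θ hθ).2.1
  have hωi : IntervalIntegrable ω volume 0 π := intervalIntegrable_of_le_prod hinj hmem he
    (measurable_jacobiDensity s α β γ hmeas) hω0 fun θ hθ => (hab θ hθ).2.2
  obtain ⟨c, hc, hmass⟩ := exists_arc_mass_lower hinj hmem hωi ha
    (fun θ hθ => (hab θ hθ).2.1) hκ1 heκ
  have hsubst := integral_eq_integral_jacobiDensity hw
  have hW : ∫ θ in (0:ℝ)..π, ω θ = ∫ x in (-1:ℝ)..1, w x := by
    simpa using (hsubst fun _ => 1).symm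
  set W := ∫ x in (-1:ℝ)..1, w x
  have hWpos : 0 < W := by
    rw [← hW]
    refine lt_of_lt_of_le ?_ (hmass 0 π le_rfl pi_pos le_rfl)
    rw [sub_zero]
    positivity
  refine ⟨W * 32 ^ κ / c, by positivity, fun n hn N hN => ?_⟩
  have hn0 : (0:ℝ) < n := by exact_mod_cast hn
  have hN0 : (0:ℝ) < N := lt_of_lt_of_le (by positivity) hN
  obtain ⟨θ, hθ⟩ := exists_nodes_of_density hωi hω0 hW hWpos hn (by exact_mod_cast hN0)
    fun a b ha hb hlt => by
      have hpos : (0:ℝ) < 1 / (32 * n) := by positivity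
      refine lt_of_lt_of_le ?_ (hmass a b ha (by linarith) hb)
      calc W / N ≤ c * (1 / (32 * n)) ^ κ := by
            rw [div_rpow zero_le_one (by positivity), one_rpow, mul_rpow (by norm_num) hn0.le,
              mul_one_div, div_le_div_iff₀ hN0 (by positivity)]
            rw [div_mul_eq_mul_div, div_le_iff₀ hc] at hN
            linarith
        _ < c * (b - a) ^ κ := by gcongr
  set t := fun i => cos (θ i)
  refine ⟨t ∘ Tuple.sort t, Tuple.monotone_sort t,
    fun i => ⟨neg_one_le_cos _, cos_le_one _⟩, fun p hp => ?_⟩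
  rw [hsubst, hθ p hp]
  congr 1
  exact (Equiv.sum_comp (Tuple.sort t) fun i => p.eval (t i)).symm

lemma exists_jacobi_card_lower (hs : Function.Injective s) (hsI : ∀ i, s i ∈ Ioo (-1:ℝ) 1)
    (hα : -1 < α) (hβ : -1 < β) (hγ : ∀ i, -1 < γ i) (hmeas : Measurable h)
    (hm : 0 < m) (hbound : ∀ x ∈ Icc (-1:ℝ) 1, m ≤ h x ∧ h x ≤ M)
    (hw : ∀ x ∈ Icc (-1:ℝ) 1,
      w x = h x * (1 - x) ^ α * (1 + x) ^ β * ∏ i, |x - s i| ^ (γ i)) (j : Option (Option σ)) :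
    ∃ c > (0:ℝ), ∀ n : ℕ, 1 ≤ n → ∀ N : ℕ, ∀ t : Fin N → ℝ, IsChebQuad w n N t →
      c * (n:ℝ) ^ (jacobiExp α β γ j + 1) ≤ N := by
  have hinj := jacobiArg_injective hs hsI
  have hmem := jacobiArg_mem s
  have he : ∀ j, -1 < jacobiExp α β γ j := by
    rintro (_ | _ | i)
    · simp only [jacobiExp]; linarith
    · simp only [jacobiExp]; linarith
    · exact hγ i
  obtain ⟨a, ha, b, hb, hab⟩ := comparableOn_jacobiDensity hsI α β γ hm hbound
  set ω := jacobiDensity s α β γ h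
  have hω0 : ∀ θ ∈ Icc 0 π, 0 ≤ ω θ := fun θ hθ =>
    (mul_nonneg ha.le (hab θ hθ).1).trans (hab θ hθ).2.1
  have hωi : IntervalIntegrable ω volume 0 π := intervalIntegrable_of_le_prod hinj hmem he
    (measurable_jacobiDensity s α β γ hmeas) hω0 fun θ hθ => (hab θ hθ).2.2
  obtain ⟨C, hC, hupper⟩ := exists_ball_mass_upper hinj hmem he hωi hb hω0
    (fun θ hθ => (hab θ hθ).2.2) j
  obtain ⟨c, hc, hlower⟩ := exists_ball_mass_lower hinj hmem he hωi ha
    (fun θ hθ => (hab θ hθ).2.1) j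
  have hsubst := integral_eq_integral_jacobiDensity hw
  have hW : ∫ θ in (0:ℝ)..π, ω θ = ∫ x in (-1:ℝ)..1, w x := by
    simpa using (hsubst fun _ => 1).symm
  have hWpos : 0 < ∫ θ in (0:ℝ)..π, ω θ := by
    rw [intervalIntegral.integral_of_le pi_nonneg, ← integral_Icc_eq_integral_Ioc]
    refine lt_of_lt_of_le (by positivity) ((hlower 1 one_pos le_rfl).trans
      (setIntegral_mono_set ((intervalIntegrable_iff_integrableOn_Icc_of_le pi_nonneg).1 hωi) ?_
        (LE.le.eventuallyLE fun θ hθ => hθ.1)))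
    exact (ae_restrict_iff' measurableSet_Icc).2 (Filter.Eventually.of_forall hω0)
  rw [hW] at hWpos
  obtain ⟨q, hq, a', ha', b', hqab⟩ : ∃ q : Polynomial ℝ, q.natDegree ≤ 2 ∧ ∃ a' > 0, ∃ b',
      ∀ θ ∈ Icc 0 π, a' * (θ - jacobiArg s j) ^ 2 ≤ q.eval (cos θ) ∧
        q.eval (cos θ) ≤ b' * (θ - jacobiArg s j) ^ 2 ∧ q.eval (cos θ) ≤ 1 := by
    rcases j with _ | _ | i
    · refine ⟨Polynomial.C (1 / 2) * (1 - Polynomial.X), by compute_degree!, 1 / π ^ 2,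
        by positivity, 1 / 4, fun θ hθ => ?_⟩
      have h1 := one_sub_cos_bounds hθ
      have h2 : 2 / π ^ 2 * θ ^ 2 = 2 * (1 / π ^ 2 * θ ^ 2) := by ring
      simp only [jacobiArg, sub_zero, Polynomial.eval_mul, Polynomial.eval_C, Polynomial.eval_sub,
        Polynomial.eval_one, Polynomial.eval_X]
      exact ⟨by linarith, by linarith, by linarith [neg_one_le_cos θ]⟩
    · refine ⟨Polynomial.C (1 / 2) * (1 + Polynomial.X), by compute_degree!, 1 / π ^ 2,
        by positivity, 1 / 4, fun θ hθ => ?_⟩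
      have h1 := one_add_cos_bounds hθ
      have h2 : 2 / π ^ 2 * (θ - π) ^ 2 = 2 * (1 / π ^ 2 * (θ - π) ^ 2) := by ring
      simp only [jacobiArg, Polynomial.eval_mul, Polynomial.eval_C, Polynomial.eval_add,
        Polynomial.eval_one, Polynomial.eval_X]
      exact ⟨by linarith, by linarith, by linarith [cos_le_one θ]⟩
    · obtain ⟨a', ha', hlow⟩ := exists_mul_abs_sub_le_abs_cos_sub_cos (arccos_mem_Ioo (hsI i))
      have hcos : cos (arccos (s i)) = s i := cos_arccos (hsI i).1.le (hsI i).2.le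
      refine ⟨Polynomial.C (1 / 4) * (Polynomial.X - Polynomial.C (s i)) ^ 2, by compute_degree!,
        a' ^ 2 / 4, by positivity, 1 / 4, fun θ hθ => ?_⟩
      have h1 := hlow θ hθ
      have h2 := abs_cos_sub_cos_le θ (arccos (s i))
      rw [hcos] at h1 h2
      have h3 : (a' * |θ - arccos (s i)|) ^ 2 ≤ |cos θ - s i| ^ 2 :=
        pow_le_pow_left₀ (by positivity) h1 2
      rw [mul_pow, sq_abs, sq_abs] at h3
      have h4 := sq_le_sq.2 h2
      simp only [jacobiArg, Polynomial.eval_mul, Polynomial.eval_C, Polynomial.eval_sub,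
        Polynomial.eval_pow, Polynomial.eval_X]
      refine ⟨by linarith, by linarith, ?_⟩
      have h5 : |cos θ - s i| ≤ 2 := abs_le.2
        ⟨by linarith [neg_one_le_cos θ, (hsI i).2], by linarith [cos_le_one θ, (hsI i).1]⟩
      have h6 := pow_le_pow_left₀ (abs_nonneg _) h5 2
      rw [sq_abs] at h6
      linarith
  obtain ⟨c', hc', hmain⟩ := exists_card_nodes_lower hωi hω0 hW hWpos (hmem j)
    (by linarith [he j]) hC hupper hc hlower q hq ha' (fun θ hθ => (hqab θ hθ).1)
    (fun θ hθ => (hqab θ hθ).2.1) (fun θ hθ => (hqab θ hθ).2.2)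
  refine ⟨c', hc', fun n hn N t ht => hmain n N hn t ht.2.1 fun p hp => ?_⟩
  exact (hsubst fun x => p.eval x).symm.trans (ht.2.2 p hp)

end Jacobi

lemma exists_mem_Ioo_notMem_range {σ : Type*} [Finite σ] (s : σ → ℝ) :
    ∃ x ∈ Ioo (-1:ℝ) 1, ∀ i, s i ≠ x := by
  obtain ⟨x, hx, hx'⟩ := ((Ioo_infinite (show (-1:ℝ) < 1 by norm_num)).sdiff
    (finite_range s)).nonempty
  exact ⟨x, hx, fun i hi => hx' ⟨i, hi⟩⟩

theorem chebyshev_quadrature_generalized_jacobi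
    (ℓ : ℕ) (s : Fin ℓ → ℝ) (hs : StrictMono s) (hs' : ∀ i, s i ∈ Ioo (-1:ℝ) 1)
    (α β : ℝ) (hα : -1 < α) (hβ : -1 < β)
    (γ : Fin ℓ → ℝ) (hγ : ∀ i, -1 < γ i)
    (h : ℝ → ℝ) (hmeas : Measurable h)
    (m M : ℝ) (hm : 0 < m) (hbound : ∀ x ∈ Icc (-1:ℝ) 1, m ≤ h x ∧ h x ≤ M)
    (w : ℝ → ℝ)
    (hw : ∀ x ∈ Icc (-1:ℝ) 1,
      w x = h x * (1 - x) ^ α * (1 + x) ^ β * ∏ i, |x - s i| ^ (γ i))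
    (hw0 : ∀ x, x ∉ Icc (-1:ℝ) 1 → w x = 0) :
    ∃ c > (0:ℝ), ∃ C > (0:ℝ), ∀ n : ℕ, 1 ≤ n →
      (∀ N : ℕ, ∀ t : Fin N → ℝ, IsChebQuad w n N t →
        c * (n : ℝ) ^ (max (max 1 (max (2*(α+1)) (2*(β+1)))) (⨆ i, (γ i + 1))) ≤ N) ∧
      (∀ N : ℕ,
        C * (n : ℝ) ^ (max (max 1 (max (2*(α+1)) (2*(β+1)))) (⨆ i, (γ i + 1))) ≤ N →
        ∃ t : Fin N → ℝ, IsChebQuad w n N t) := by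
  set κ := max (max 1 (max (2*(α+1)) (2*(β+1)))) (⨆ i, (γ i + 1)) with hκ
  have hκ1 : 1 ≤ κ := (le_max_left _ _).trans (le_max_left _ _)
  have hκα : 2 * (α + 1) ≤ κ :=
    (le_max_left _ _).trans ((le_max_right _ _).trans (le_max_left _ _))
  have hκβ : 2 * (β + 1) ≤ κ :=
    (le_max_right _ _).trans ((le_max_right _ _).trans (le_max_left _ _))
  have hκγ : ∀ i, γ i + 1 ≤ κ := fun i =>
    (le_ciSup (f := fun i => γ i + 1) (finite_range _).bddAbove i).trans (le_max_right _ _)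
  -- a fictitious singularity with exponent zero accounts for the exponent `1` in `κ`
  obtain ⟨x₀, hx₀, hx₀s⟩ := exists_mem_Ioo_notMem_range s
  let s' : Option (Fin ℓ) → ℝ := fun i => i.elim x₀ s
  let γ' : Option (Fin ℓ) → ℝ := fun i => i.elim 0 γ
  have hs'inj : Function.Injective s' := by
    rintro (_ | i) (_ | j) hij
    · rfl
    · exact absurd hij.symm (hx₀s j)
    · exact absurd hij (hx₀s i)
    · exact congrArg some (hs.injective hij)
  have hs'I : ∀ i, s' i ∈ Ioo (-1:ℝ) 1 := by
    rintro (_ | i)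
    exacts [hx₀, hs' i]
  have hγ' : ∀ i, -1 < γ' i := by
    rintro (_ | i)
    · exact neg_one_lt_zero
    · exact hγ i
  have hκγ' : ∀ i, γ' i + 1 ≤ κ := by
    rintro (_ | i)
    · simpa [γ'] using hκ1
    · exact hκγ i
  have hw' : ∀ x ∈ Icc (-1:ℝ) 1,
      w x = h x * (1 - x) ^ α * (1 + x) ^ β * ∏ i, |x - s' i| ^ (γ' i) := fun x hx => by
    simp [hw x hx, Fintype.prod_option, s', γ']
  obtain ⟨j, hj⟩ : ∃ j, jacobiExp α β γ' j + 1 = κ := by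
    rcases max_choice (max 1 (max (2*(α+1)) (2*(β+1)))) (⨆ i, (γ i + 1)) with h1 | h1
    · rw [← hκ] at h1
      rcases max_choice 1 (max (2*(α+1)) (2*(β+1))) with h2 | h2
      · exact ⟨some (some none), by rw [h1, h2]; simp [jacobiExp, γ']⟩
      · rcases max_choice (2*(α+1)) (2*(β+1)) with h3 | h3
        · exact ⟨none, by rw [h1, h2, h3]; simp only [jacobiExp]; ring⟩
        · exact ⟨some none, by rw [h1, h2, h3]; simp only [jacobiExp]; ring⟩
    · rw [← hκ] at h1
      rcases isEmpty_or_nonempty (Fin ℓ) with hE | hE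
      · rw [Real.iSup_of_isEmpty] at h1
        linarith
      · obtain ⟨i, hi⟩ := exists_eq_ciSup_of_finite (f := fun i => γ i + 1)
        exact ⟨some (some (some i)), by rw [h1]; exact hi⟩
  obtain ⟨c, hc, hlow⟩ := exists_jacobi_card_lower hs'inj hs'I hα hβ hγ' hmeas hm hbound hw' j
  obtain ⟨C, hC, hup⟩ := exists_jacobi_chebQuad hs'inj hs'I hα hβ hγ' hmeas hm hbound hw'
    hκ1 hκα hκβ hκγ'
  rw [hj] at hlow
  exact ⟨c, hc, C, hC, fun n hn => ⟨hlow n hn, hup n hn⟩⟩
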